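/- arXiv:1310.8157 — 4 statements merged into one kernel-verified Lean document; each statement's English description precedes it below -/
import Mathlib

section
/- Let n ≥ 2 be a natural number. If G is a subgroup of the group of all permutations of ℚ^n that properly contains AGL_n(ℚ), then G is highly transitive, i.e., for every k ≥ 1 and any two k-tuples of pairwise distinct points of ℚ^n there is an element of G mapping the first tuple to the second. (This is the content of the maximality of AGL_n(ℚ) as a closed subgroup of S_ω.) -/
/-- `σ` is an element of `AGL_n(ℚ)`: a permutation of `ℚ^n` of the form
`x ↦ T x + b` with `T` an invertible `ℚ`-linear map and `b ∈ ℚ^n`. -/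
def IsAGL (n : ℕ) (σ : Equiv.Perm (Fin n → ℚ)) : Prop :=
  ∃ T : (Fin n → ℚ) ≃ₗ[ℚ] (Fin n → ℚ), ∃ b : Fin n → ℚ, ∀ x, σ x = T x + b

section AffineGeometry

variable {V : Type*} [AddCommGroup V] [Module ℚ V]

/-- The line through `p` with direction `d` (a single point when `d = 0`). -/
def ratLine (p d : V) : Set V := {x | ∃ t : ℚ, x = p + t • d}

/-- The permutation `x ↦ T x + b`. -/
def affinePerm (T : V ≃ₗ[ℚ] V) (b : V) : Equiv.Perm V := T.toEquiv.trans (Equiv.addRight b)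

@[simp]
theorem affinePerm_apply (T : V ≃ₗ[ℚ] V) (b x : V) : affinePerm T b x = T x + b := rfl

/-- The group `G` contains all invertible affine maps. -/
def ContainsAffine (G : Subgroup (Equiv.Perm V)) : Prop :=
  ∀ (T : V ≃ₗ[ℚ] V) (b : V), affinePerm T b ∈ G

theorem base_mem_ratLine (p d : V) : p ∈ ratLine p d := ⟨0, by simp⟩

theorem add_smul_mem_ratLine (p d : V) (t : ℚ) : p + t • d ∈ ratLine p d := ⟨t, rfl⟩

theorem mem_ratLine_sub (a b : V) : b ∈ ratLine a (b - a) := ⟨1, by simp⟩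

theorem ratLine_eq_of_mem {p d a b : V} (ha : a ∈ ratLine p d) (hb : b ∈ ratLine p d)
    (hab : a ≠ b) : ratLine p d = ratLine a (b - a) := by
  obtain ⟨s, rfl⟩ := ha
  obtain ⟨t, rfl⟩ := hb
  have hst : t - s ≠ 0 := by
    intro h
    exact hab (by rw [sub_eq_zero.mp h])
  ext x
  constructor
  · rintro ⟨r, rfl⟩
    refine ⟨(r - s) / (t - s), ?_⟩
    have : p + t • d - (p + s • d) = (t - s) • d := by module
    rw [this, smul_smul, div_mul_cancel₀ _ hst]
    module
  · rintro ⟨r, rfl⟩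
    exact ⟨s + r * (t - s), by module⟩

theorem ratLine_eq_of_mem_of_mem {p d q e a b : V} (ha : a ∈ ratLine p d) (hb : b ∈ ratLine p d)
    (ha' : a ∈ ratLine q e) (hb' : b ∈ ratLine q e) (hab : a ≠ b) : ratLine p d = ratLine q e := by
  rw [ratLine_eq_of_mem ha hb hab, ratLine_eq_of_mem ha' hb' hab]

theorem add_smul_injective (p : V) {d : V} (hd : d ≠ 0) :
    Function.Injective fun t : ℚ => p + t • d := by
  intro s t h
  exact smul_left_injective ℚ hd (add_left_cancel h)

theorem infinite_ratLine (p : V) {d : V} (hd : d ≠ 0) : (ratLine p d).Infinite :=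
  Set.infinite_of_injective_forall_mem (add_smul_injective p hd) (add_smul_mem_ratLine p d)

theorem image_affinePerm_ratLine (T : V ≃ₗ[ℚ] V) (b p d : V) :
    affinePerm T b '' ratLine p d = ratLine (T p + b) (T d) := by
  ext x
  constructor
  · rintro ⟨_, ⟨t, rfl⟩, rfl⟩
    exact ⟨t, by simp; abel⟩
  · rintro ⟨t, rfl⟩
    exact ⟨_, ⟨t, rfl⟩, by simp; abel⟩

/-- No line covers the whole space. -/
theorem exists_notMem_ratLine (hdim : ∀ d : V, ∃ v, ∀ t : ℚ, v ≠ t • d) (p d : V) :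
    ∃ x, x ∉ ratLine p d := by
  obtain ⟨v, hv⟩ := hdim d
  refine ⟨p + v, ?_⟩
  rintro ⟨t, ht⟩
  exact hv t (add_left_cancel ht)

/-- A transvection or dilation moving `u` to `w` along `w - u`. -/
theorem exists_linearEquiv_apply_eq (φ : V →ₗ[ℚ] ℚ) {u w : V} (hu : φ u ≠ 0) (hw : φ w ≠ 0) :
    ∃ T : V ≃ₗ[ℚ] V, ∀ v, T v = v + (φ v / φ u) • (w - u) := by
  have h : IsUnit (1 + ((φ u)⁻¹ • φ) (w - u)) := by
    rw [isUnit_iff_ne_zero]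
    have : (1 : ℚ) + ((φ u)⁻¹ • φ) (w - u) = φ w / φ u := by
      simp only [LinearMap.smul_apply, map_sub, smul_eq_mul]
      field_simp
      ring
    rw [this]
    exact div_ne_zero hw hu
  refine ⟨LinearEquiv.dilatransvection h, fun v => ?_⟩
  have : LinearEquiv.dilatransvection h v = v + (((φ u)⁻¹ • φ) v) • (w - u) := rfl
  rw [this]
  simp only [LinearMap.smul_apply, smul_eq_mul]
  congr 2
  field_simp

/-- A functional vanishing on `d` and on none of finitely many vectors outside the line `ℚ d`. -/
theorem exists_functional {ι : Type*} [Finite ι] (d : V) (v : ι → V)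
    (hv : ∀ i, ∀ t : ℚ, v i ≠ t • d) :
    ∃ φ : V →ₗ[ℚ] ℚ, φ d = 0 ∧ ∀ i, φ (v i) ≠ 0 := by
  obtain ⟨f, hf⟩ := Module.exists_dual_forall_apply_ne_zero (K := ℚ)
    (fun i => (Submodule.span ℚ {d}).mkQ (v i)) (fun i h => by
      rw [Submodule.mkQ_apply, Submodule.Quotient.mk_eq_zero, Submodule.mem_span_singleton] at h
      obtain ⟨t, ht⟩ := h
      exact hv i t ht.symm)
  refine ⟨f ∘ₗ (Submodule.span ℚ {d}).mkQ, ?_, hf⟩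
  rw [LinearMap.comp_apply, Submodule.mkQ_apply,
    (Submodule.Quotient.mk_eq_zero _).mpr (Submodule.mem_span_singleton_self d), map_zero]

theorem exists_functional_of_notMem_ratLine {ι : Type*} [Finite ι] (p d : V) (x : ι → V)
    (hx : ∀ i, x i ∉ ratLine p d) :
    ∃ φ : V →ₗ[ℚ] ℚ, φ d = 0 ∧ ∀ i, φ (x i - p) ≠ 0 :=
  exists_functional d (fun i => x i - p) fun i t h => hx i ⟨t, by rw [← h]; abel⟩

/-- Two-transitivity of the affine group. -/
theorem exists_affinePerm_pair {a b x y : V} (hab : a ≠ b) (hxy : x ≠ y) :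
    ∃ (T : V ≃ₗ[ℚ] V) (c : V), affinePerm T c a = x ∧ affinePerm T c b = y := by
  obtain ⟨φ, -, hφ⟩ := exists_functional (0 : V) ![b - a, y - x] (by
    intro i t
    fin_cases i
    · simpa using sub_ne_zero.mpr hab.symm
    · simpa using sub_ne_zero.mpr hxy.symm)
  have h0 : φ (b - a) ≠ 0 := hφ 0
  have h1 : φ (y - x) ≠ 0 := hφ 1
  obtain ⟨T, hT⟩ := exists_linearEquiv_apply_eq φ h0 h1
  have hTba : T (b - a) = y - x := by rw [hT, div_self h0]; module
  refine ⟨T, x - T a, by simp, ?_⟩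
  have : affinePerm T (x - T a) b = T (b - a) + x := by simp; abel
  rw [this, hTba, sub_add_cancel]

theorem infinite_of_forall_add_smul_mem {z w : V} (hzw : w ≠ 0) {c : ℚ} (hc0 : c ≠ 0)
    (hc1 : c ≠ -1) {h : Equiv.Perm V} (hh : ∀ s : ℚ, h (z + s • w) = z + (1 + c * s) • w)
    {C : Set V} (hC : ∀ x ∈ C, h x ∈ C) (hy : z + w ∈ C) : (C ∩ ratLine z w).Infinite := by
  have key : ∀ j : ℕ, z + (∑ i ∈ Finset.range (j + 1), c ^ i) • w ∈ C := by
    intro j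
    induction j with
    | zero => simpa using hy
    | succ j ih =>
      have := hC _ ih
      rw [hh] at this
      rwa [geom_sum_succ, add_comm (c * _)]
  refine Set.infinite_of_injective_forall_mem
    (f := fun j : ℕ => z + (∑ i ∈ Finset.range (j + 1), c ^ i) • w) ?_
    fun j => ⟨key j, add_smul_mem_ratLine _ _ _⟩
  intro i j hij
  have hij' := add_smul_injective z hzw hij
  wlog hlt : i ≤ j generalizing i j
  · exact (this hij.symm hij'.symm (le_of_not_ge hlt)).symm
  obtain ⟨m, rfl⟩ := Nat.exists_eq_add_of_le hlt
  by_contra hne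
  have hm : m ≠ 0 := by rintro rfl; exact hne rfl
  rw [show i + m + 1 = (i + 1) + m by ring, Finset.sum_range_add _ (i + 1) m] at hij'
  have h0 : ∑ x ∈ Finset.range m, c ^ (i + 1 + x) = 0 := by linarith
  simp_rw [pow_add c (i + 1)] at h0
  rw [← Finset.mul_sum] at h0
  exact mul_ne_zero (pow_ne_zero _ hc0) (geom_sum_ne_zero hc1 hm) h0

/-- If `φ` vanishes on the direction of a line, two points at which it does not vanish are
exchanged by, or connected by an infinite collinear orbit of, an affine map fixing the line. -/
theorem exists_affinePerm_fixing_ratLine {p d z y : V} (hzy : z ≠ y) (φ : V →ₗ[ℚ] ℚ) (hd : φ d = 0)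
    (hz : φ (z - p) ≠ 0) (hy : φ (y - p) ≠ 0) :
    ∃ (T : V ≃ₗ[ℚ] V) (b : V), (∀ x ∈ ratLine p d, affinePerm T b x = x) ∧
      affinePerm T b z = y ∧ ((φ (y - p) = -φ (z - p) ∧ affinePerm T b y = z) ∨
        ∀ C : Set V, y ∈ C → (∀ x ∈ C, affinePerm T b x ∈ C) →
          (C ∩ ratLine z (y - z)).Infinite) := by
  obtain ⟨T, hT⟩ := exists_linearEquiv_apply_eq φ hz hy
  have hform : ∀ x, affinePerm T (p - T p) x = x + (φ (x - p) / φ (z - p)) • (y - z) := by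
    intro x
    have : affinePerm T (p - T p) x = T (x - p) + p := by simp; abel
    rw [this, hT]
    module
  have hline : ∀ s : ℚ, affinePerm T (p - T p) (z + s • (y - z)) =
      z + (1 + (φ (y - p) / φ (z - p)) * s) • (y - z) := by
    intro s
    rw [hform]
    have : φ (z + s • (y - z) - p) = φ (z - p) + s * (φ (y - p) - φ (z - p)) := by
      simp only [map_sub, map_add, map_smul, smul_eq_mul]; ring
    rw [this, add_assoc, ← add_smul]
    congr 2
    field_simp
    ring
  refine ⟨T, p - T p, ?_, ?_, ?_⟩
  · rintro _ ⟨t, rfl⟩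
    rw [hform]
    simp [hd]
  · rw [hform, div_self hz]; simp
  · by_cases h : φ (y - p) = -φ (z - p)
    · refine Or.inl ⟨h, ?_⟩
      rw [hform, h, neg_div, div_self hz]
      module
    · refine Or.inr fun C hyC hC => ?_
      refine infinite_of_forall_add_smul_mem (sub_ne_zero.mpr hzy.symm) (div_ne_zero hy hz) ?_
        hline hC (by simpa using hyC)
      intro h'
      rw [div_eq_iff hz] at h'
      exact h (by linarith)

open scoped Pointwise in
/-- Finitely many lines do not cover the whole space. -/
theorem exists_notMem_ratLines (hdim : ∀ d : V, ∃ v, ∀ t : ℚ, v ≠ t • d) (s : Finset (V × V)) :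
    ∃ z, ∀ q ∈ s, z ∉ ratLine q.1 q.2 := by
  by_contra! hcon
  have hcov : ⋃ q ∈ s, q.1 +ᵥ ((Submodule.span ℚ {q.2}).toAddSubgroup : Set V) = Set.univ := by
    ext z
    simp only [Set.mem_iUnion, Set.mem_univ, iff_true]
    obtain ⟨q, hq, t, ht⟩ := hcon z
    refine ⟨q, hq, t • q.2, ?_, ht.symm⟩
    exact Submodule.smul_mem _ _ (Submodule.mem_span_singleton_self _)
  obtain ⟨q, -, hq⟩ := AddSubgroup.exists_finiteIndex_of_leftCoset_cover hcov
  obtain ⟨v, hv⟩ := hdim q.2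
  obtain ⟨n, hn, -, hmem⟩ := AddSubgroup.exists_nsmul_mem_of_index_ne_zero hq.index_ne_zero v
  obtain ⟨t, ht⟩ := Submodule.mem_span_singleton.mp
    (show n • v ∈ Submodule.span ℚ {q.2} from hmem)
  refine hv ((n : ℚ)⁻¹ * t) ?_
  rw [mul_smul, ht, ← Nat.cast_smul_eq_nsmul ℚ, smul_smul,
    inv_mul_cancel₀ (by exact_mod_cast hn.ne'), one_smul]

end AffineGeometry

section FundamentalTheorem

variable {V : Type*} [AddCommGroup V] [Module ℚ V]

/-- A permutation maps lines into lines. -/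
def MapsLines (g : Equiv.Perm V) : Prop :=
  ∀ a d : V, d ≠ 0 → ∀ t : ℚ, g (a + t • d) ∈ ratLine (g a) (g (a + d) - g a)

theorem MapsLines.coeff_eq_one {g : Equiv.Perm V} (hg' : MapsLines g⁻¹) (h0 : g 0 = 0) {a b : V}
    (ha : a ≠ 0) (hb : ∀ t : ℚ, b ≠ t • a) {α β : ℚ}
    (hab : g (a + b) = α • g a + β • g b) : β = 1 := by
  by_contra hβ
  have hβ' : β - 1 ≠ 0 := sub_ne_zero.mpr hβ
  have hga : g a ≠ 0 := fun h => ha (g.injective (h.trans h0.symm))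
  have hgab : g (a + b) - g b ≠ 0 := by
    intro h
    have := g.injective (sub_eq_zero.mp h)
    exact ha (by simpa using this)
  -- the point of intersection of the images of two parallel lines
  have hpt : g b + (-(1 / (β - 1))) • (g (a + b) - g b) = 0 + (-(α / (β - 1))) • g a := by
    rw [hab]
    match_scalars
    · field_simp
      ring
    · field_simp
  obtain ⟨s, hs⟩ := hg' (g b) (g (a + b) - g b) hgab (-(1 / (β - 1)))
  obtain ⟨t, ht⟩ := hg' 0 (g a) hga (-(α / (β - 1)))
  rw [hpt, ht] at hs
  have hinv0 : g⁻¹ 0 = 0 := by rw [Equiv.Perm.inv_eq_iff_eq, h0]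
  have hinv : ∀ x, g⁻¹ (g x) = x := g.symm_apply_apply
  simp only [zero_add, add_sub_cancel, hinv0, hinv, sub_zero] at hs
  refine hb (t - s) ?_
  have : b = (b + s • (a + b - b)) - s • a := by rw [add_sub_cancel_right]; abel
  rw [this, ← hs]
  module

theorem MapsLines.map_add_of_independent {g : Equiv.Perm V} (hg : MapsLines g)
    (hg' : MapsLines g⁻¹) (h0 : g 0 = 0) {a b : V} (ha : a ≠ 0) (hb : ∀ t : ℚ, b ≠ t • a) :
    g (a + b) = g a + g b := by
  have hba : b - a ≠ 0 := sub_ne_zero.mpr (by simpa using hb 1)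
  have hb0 : b ≠ 0 := by simpa using hb 0
  have ha' : ∀ t : ℚ, a ≠ t • b := by
    intro t h
    have ht : t ≠ 0 := by rintro rfl; exact ha (by simpa using h)
    refine hb t⁻¹ ?_
    rw [h, smul_smul, inv_mul_cancel₀ ht, one_smul]
  have hm0 : (1 / 2 : ℚ) • (a + b) ≠ 0 := by
    rw [smul_ne_zero_iff]
    refine ⟨by norm_num, fun h => hb (-1) ?_⟩
    rw [neg_one_smul]
    exact (neg_eq_of_add_eq_zero_right h).symm
  obtain ⟨s, hs⟩ := hg a (b - a) hba (1 / 2)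
  obtain ⟨t, ht⟩ := hg 0 _ hm0 2
  have e1 : (0 : V) + (2 : ℚ) • (1 / 2 : ℚ) • (a + b) = a + b := by module
  have e2 : a + (1 / 2 : ℚ) • (b - a) = (1 / 2 : ℚ) • (a + b) := by module
  rw [e1, zero_add, h0, sub_zero, zero_add] at ht
  rw [e2, add_sub_cancel] at hs
  rw [hs] at ht
  have hab : g (a + b) = (t * (1 - s)) • g a + (t * s) • g b := by rw [ht]; module
  have hβ := hg'.coeff_eq_one h0 ha hb hab
  have hα := hg'.coeff_eq_one (α := t * s) (β := t * (1 - s)) h0 hb0 ha'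
    (by rw [add_comm b a, hab, add_comm])
  rw [hab, hα, hβ, one_smul, one_smul]

/-- The fundamental theorem of affine geometry over `ℚ`. -/
theorem MapsLines.exists_eq_affinePerm (hdim : ∀ d : V, ∃ v, ∀ t : ℚ, v ≠ t • d)
    {g : Equiv.Perm V} (hg : MapsLines g) (hg' : MapsLines g⁻¹) (h0 : g 0 = 0) :
    ∃ T : V ≃ₗ[ℚ] V, ∀ x, g x = T x := by
  have hadd : ∀ a b, g (a + b) = g a + g b := by
    intro a b
    by_cases ha : a = 0
    · simp [ha, h0]
    by_cases hb : ∀ t : ℚ, b ≠ t • a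
    · exact hg.map_add_of_independent hg' h0 ha hb
    push Not at hb
    obtain ⟨t, rfl⟩ := hb
    obtain ⟨c, hc⟩ := hdim a
    have e1 : g (a + (t • a + c)) = g a + g (t • a + c) :=
      hg.map_add_of_independent hg' h0 ha fun r hr => hc (r - t) (by
        rw [sub_smul, ← hr]; abel)
    have e2 : ∀ s : ℚ, g (s • a + c) = g (s • a) + g c := by
      intro s
      by_cases hs : s = 0
      · simp [hs, h0]
      · exact hg.map_add_of_independent hg' h0 (smul_ne_zero hs ha) fun r hr =>
          hc (r * s) (by rw [hr, smul_smul])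
    have e3 : g (a + (t • a + c)) = g (a + t • a) + g c := by
      have := e2 (1 + t)
      rw [add_smul, one_smul] at this
      rw [← this, add_assoc]
    rw [e2, e3, ← add_assoc] at e1
    exact add_right_cancel e1
  let φ : V →ₗ[ℚ] V := (AddMonoidHom.mk' g hadd).toRatLinearMap
  exact ⟨LinearEquiv.ofBijective φ g.bijective, fun x => rfl⟩

end FundamentalTheorem

section Transitivity

variable {V : Type*} {G : Subgroup (Equiv.Perm V)}

/-- `k`-transitivity. -/
def IsTransitiveOn (G : Subgroup (Equiv.Perm V)) (k : ℕ) : Prop :=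
  ∀ f g : Fin k → V, Function.Injective f → Function.Injective g →
    ∃ σ ∈ G, ∀ i, σ (f i) = g i

theorem isTransitiveOn_succ {k : ℕ} (hk : IsTransitiveOn G k)
    (h : ∀ A : Finset V, A.card = k → ∀ x y, x ∉ A → y ∉ A →
      ∃ g ∈ G, (∀ a ∈ A, g a = a) ∧ g x = y) : IsTransitiveOn G (k + 1) := by
  classical
  intro f f' hf hf'
  obtain ⟨σ, hσ, hσf⟩ := hk (fun i => f i.succ) (fun i => f' i.succ)
    (hf.comp (Fin.succ_injective k)) (hf'.comp (Fin.succ_injective k))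
  obtain ⟨g, hg, hgA, hgx⟩ := h (Finset.univ.image fun i : Fin k => f' i.succ)
    ((Finset.card_image_of_injective _ (hf'.comp (Fin.succ_injective k))).trans
      (Finset.card_fin k))
    (σ (f 0)) (f' 0)
    (by
      simp only [Finset.mem_image, Finset.mem_univ, true_and, not_exists]
      intro i hi
      rw [← hσf i] at hi
      exact Fin.succ_ne_zero i (hf (σ.injective hi)))
    (by
      simp only [Finset.mem_image, Finset.mem_univ, true_and, not_exists]
      intro i hi
      exact Fin.succ_ne_zero i (hf' hi))
  refine ⟨g * σ, G.mul_mem hg hσ, fun i => ?_⟩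
  rw [Equiv.Perm.mul_apply]
  cases i using Fin.cases with
  | zero => exact hgx
  | succ i =>
    rw [hσf]
    exact hgA _ (by simp)

theorem isTransitiveOn_zero : IsTransitiveOn G 0 := fun _ _ _ _ => ⟨1, G.one_mem, fun i => i.elim0⟩

theorem exists_injective_range_eq {k : ℕ} {A : Finset V} (hA : A.card = k) :
    ∃ f : Fin k → V, Function.Injective f ∧ Set.range f = A :=
  ⟨Subtype.val ∘ (A.equivFinOfCardEq hA).symm,
    Subtype.val_injective.comp (A.equivFinOfCardEq hA).symm.injective, by
      rw [Set.range_comp, (A.equivFinOfCardEq hA).symm.range_eq_univ, Set.image_univ,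
        Subtype.range_coe_subtype, Finset.setOfPred_mem]⟩

theorem IsTransitiveOn.exists_image_eq {k : ℕ} (hk : IsTransitiveOn G k) {A B : Finset V}
    (hA : A.card = k) (hB : B.card = k) : ∃ g ∈ G, g '' (A : Set V) = B := by
  obtain ⟨f, hf, hfA⟩ := exists_injective_range_eq hA
  obtain ⟨f', hf', hfB⟩ := exists_injective_range_eq hB
  obtain ⟨g, hg, hgf⟩ := hk f f' hf hf'
  refine ⟨g, hg, ?_⟩
  rw [← hfA, ← hfB, ← Set.range_comp]
  exact congrArg Set.range (funext hgf)

theorem IsTransitiveOn.exists_image_eq_apply_eq {k : ℕ} (hk : IsTransitiveOn G (k + 1))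
    {A B : Finset V} (hA : A.card = k) (hB : B.card = k) {a b : V} (ha : a ∉ A) (hb : b ∉ B) :
    ∃ g ∈ G, g '' (A : Set V) = B ∧ g a = b := by
  obtain ⟨f, hf, hfA⟩ := exists_injective_range_eq hA
  obtain ⟨f', hf', hfB⟩ := exists_injective_range_eq hB
  obtain ⟨g, hg, hgf⟩ := hk (Fin.cons a f) (Fin.cons b f')
    (Fin.cons_injective_iff.mpr ⟨by rw [hfA]; exact_mod_cast ha, hf⟩)
    (Fin.cons_injective_iff.mpr ⟨by rw [hfB]; exact_mod_cast hb, hf'⟩)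
  refine ⟨g, hg, ?_, by simpa using hgf 0⟩
  rw [← hfA, ← hfB, ← Set.range_comp]
  exact congrArg Set.range (funext fun i => by simpa using hgf i.succ)

end Transitivity

section Closure

variable {V : Type*} [AddCommGroup V] [Module ℚ V] {G : Subgroup (Equiv.Perm V)}

/-- A translate of a line by an element of `G`. -/
def IsCurve (G : Subgroup (Equiv.Perm V)) (C : Set V) : Prop :=
  ∃ g ∈ G, ∃ p d : V, d ≠ 0 ∧ C = g '' ratLine p d

/-- The intersection of all curves containing `A`. -/
def curveClosure (G : Subgroup (Equiv.Perm V)) (A : Set V) : Set V :=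
  {x | ∀ C, IsCurve G C → A ⊆ C → x ∈ C}

/-- No two curves cover the space. -/
def NoCurveCover (G : Subgroup (Equiv.Perm V)) : Prop :=
  ∀ C C', IsCurve G C → IsCurve G C' → ∃ z, z ∉ C ∧ z ∉ C'

theorem isCurve_ratLine (p : V) {d : V} (hd : d ≠ 0) : IsCurve G (ratLine p d) :=
  ⟨1, G.one_mem, p, d, hd, by simp⟩

theorem IsCurve.image {C : Set V} (hC : IsCurve G C) {g : Equiv.Perm V} (hg : g ∈ G) :
    IsCurve G (g '' C) := by
  obtain ⟨σ, hσ, p, d, hd, rfl⟩ := hC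
  exact ⟨g * σ, G.mul_mem hg hσ, p, d, hd, by simp [Set.image_image]⟩

theorem IsCurve.exists_notMem (hdim : ∀ d : V, ∃ v, ∀ t : ℚ, v ≠ t • d) {C : Set V}
    (hC : IsCurve G C) : ∃ z, z ∉ C := by
  obtain ⟨σ, -, p, d, -, rfl⟩ := hC
  obtain ⟨x, hx⟩ := exists_notMem_ratLine hdim p d
  exact ⟨σ x, by simpa using hx⟩

/-- The stabiliser of a curve is transitive on its complement. -/
theorem IsCurve.exists_fixing (hG : ContainsAffine G) {C : Set V} (hC : IsCurve G C) {x y : V}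
    (hx : x ∉ C) (hy : y ∉ C) : ∃ g ∈ G, (∀ a ∈ C, g a = a) ∧ g x = y := by
  obtain ⟨σ, hσ, p, d, -, rfl⟩ := hC
  by_cases hxy : x = y
  · exact ⟨1, G.one_mem, by simp, by simpa using hxy⟩
  have hσσ : ∀ a, σ (σ⁻¹ a) = a := σ.apply_symm_apply
  have hσσ' : ∀ a, σ⁻¹ (σ a) = a := σ.symm_apply_apply
  have hmem : ∀ a, a ∉ σ '' ratLine p d → σ⁻¹ a ∉ ratLine p d :=
    fun a ha h => ha ⟨_, h, hσσ a⟩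
  obtain ⟨φ, hφd, hφ⟩ := exists_functional_of_notMem_ratLine p d ![σ⁻¹ x, σ⁻¹ y] (by
    intro i
    fin_cases i
    · exact hmem x hx
    · exact hmem y hy)
  obtain ⟨T, b, hfix, hT, -⟩ := exists_affinePerm_fixing_ratLine (p := p)
    (fun h => hxy (σ⁻¹.injective h)) φ hφd (hφ 0) (hφ 1)
  refine ⟨σ * affinePerm T b * σ⁻¹, G.mul_mem (G.mul_mem hσ (hG T b)) (G.inv_mem hσ), ?_, ?_⟩
  · rintro _ ⟨a, ha, rfl⟩
    simp only [Equiv.Perm.mul_apply, hσσ', hfix a ha]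
  · simp only [Equiv.Perm.mul_apply, hT, hσσ]

theorem subset_curveClosure (A : Set V) : A ⊆ curveClosure G A := fun _ hx _ _ hA => hA hx

theorem curveClosure_mono {A B : Set V} (h : A ⊆ curveClosure G B) :
    curveClosure G A ⊆ curveClosure G B :=
  fun _ hx C hC hBC => hx C hC fun _ ha => h ha C hC hBC

theorem apply_mem_curveClosure {g : Equiv.Perm V} (hg : g ∈ G) {A : Set V} {x : V}
    (hx : x ∈ curveClosure G A) : g x ∈ curveClosure G (g '' A) := by
  intro C hC hA
  have h := hx ((g⁻¹ : Equiv.Perm V) '' C) (hC.image (G.inv_mem hg)) (by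
    intro a ha
    exact ⟨g a, hA ⟨a, ha, rfl⟩, g.symm_apply_apply a⟩)
  obtain ⟨c, hc, hcx⟩ := h
  rw [← hcx, show g (g⁻¹ c) = c from g.apply_symm_apply c]
  exact hc

theorem curveClosure_image {g : Equiv.Perm V} (hg : g ∈ G) (A : Set V) :
    curveClosure G (g '' A) = g '' curveClosure G A := by
  refine Set.Subset.antisymm ?_ ?_
  · intro x hx
    refine ⟨g⁻¹ x, ?_, g.apply_symm_apply x⟩
    have := apply_mem_curveClosure (G.inv_mem hg) hx
    rw [Set.image_image] at this
    simpa [show ∀ a, g⁻¹ (g a) = a from g.symm_apply_apply] using this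
  · rintro _ ⟨x, hx, rfl⟩
    exact apply_mem_curveClosure hg hx

theorem exists_curve_of_notMem {A : Set V} {x : V} (hx : x ∉ curveClosure G A) :
    ∃ C, IsCurve G C ∧ A ⊆ C ∧ x ∉ C := by
  simpa [curveClosure] using hx

/-- The pointwise stabiliser of `A` is transitive on the complement of the closure of `A`. -/
theorem exists_fixing_of_notMem_curveClosure (hG : ContainsAffine G) (hN : NoCurveCover G)
    {A : Set V} {x y : V} (hx : x ∉ curveClosure G A) (hy : y ∉ curveClosure G A) :
    ∃ g ∈ G, (∀ a ∈ A, g a = a) ∧ g x = y := by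
  obtain ⟨C, hC, hAC, hxC⟩ := exists_curve_of_notMem hx
  obtain ⟨C', hC', hAC', hyC'⟩ := exists_curve_of_notMem hy
  obtain ⟨z, hz, hz'⟩ := hN C C' hC hC'
  obtain ⟨g, hg, hgA, hgx⟩ := hC.exists_fixing hG hxC hz
  obtain ⟨g', hg', hgA', hgz⟩ := hC'.exists_fixing hG hz' hyC'
  refine ⟨g' * g, G.mul_mem hg' hg, fun a ha => ?_, ?_⟩
  · rw [Equiv.Perm.mul_apply, hgA a (hAC ha), hgA' a (hAC' ha)]
  · rw [Equiv.Perm.mul_apply, hgx, hgz]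

/-- If two curves cover the space, pointwise stabilisers of finite sets are transitive on the
complement. -/
theorem exists_fixing_of_not_noCurveCover (hdim : ∀ d : V, ∃ v, ∀ t : ℚ, v ≠ t • d)
    (hG : ContainsAffine G) (hN : ¬ NoCurveCover G) (A : Finset V) {x y : V} (hx : x ∉ A)
    (hy : y ∉ A) : ∃ g ∈ G, (∀ a ∈ A, g a = a) ∧ g x = y := by
  classical
  unfold NoCurveCover at hN
  push Not at hN
  obtain ⟨C, C', hC, ⟨σ, hσ, p, d, hd, rfl⟩, hcov⟩ := hN
  -- reduce to the case where the second curve is a line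
  set D := (σ⁻¹ : Equiv.Perm V) '' C with hD
  have hDc : IsCurve G D := hC.image (G.inv_mem hσ)
  have hDL : ∀ z, z ∉ D → z ∈ ratLine p d := by
    intro z hz
    by_contra hzL
    refine hzL ((Function.Injective.mem_set_image σ.injective).mp (hcov (σ z) fun h => hz ?_))
    exact ⟨σ z, h, σ.symm_apply_apply z⟩
  obtain ⟨j₁, j₂, hj, hj₁, hj₂⟩ : ∃ j₁ j₂ : V, j₁ ≠ j₂ ∧ j₁ ∉ D ∧ j₂ ∉ D := by
    obtain ⟨τ, -, q, e, he, hτ⟩ := hDc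
    obtain ⟨w, hw⟩ := exists_notMem_ratLine hdim q e
    have hw0 : w - q ≠ 0 := by
      intro h
      exact hw ⟨0, by rw [zero_smul, add_zero]; exact sub_eq_zero.mp h⟩
    have hw' : w + e ∉ ratLine q e := by
      rintro ⟨t, ht⟩
      exact hw ⟨t - 1, by rw [sub_smul, one_smul, add_sub, ← ht, add_sub_cancel_right]⟩
    refine ⟨τ w, τ (w + e), fun h => he ?_, ?_, ?_⟩
    · simpa using τ.injective h
    · rw [hτ]; simpa using hw
    · rw [hτ]; simpa using hw'
  have step : ∀ u z : V, u ∉ A → u ≠ z → (∀ a ∈ A, a ∉ ratLine u (z - u)) →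
      ∃ g ∈ G, (∀ a ∈ A, g a = a) ∧ g u = z := by
    intro u z hu huz hline
    obtain ⟨T, b, h₁, h₂⟩ := exists_affinePerm_pair hj huz
    have hnot : ∀ j, j ∉ D → affinePerm T b j ∉ affinePerm T b '' D := fun j hj =>
      (Function.Injective.mem_set_image (affinePerm T b).injective).not.mpr hj
    obtain ⟨g, hg, hgC, hgu⟩ := (hDc.image (hG T b)).exists_fixing hG (hnot _ hj₁) (hnot _ hj₂)
    rw [h₁, h₂] at hgu
    refine ⟨g, hg, fun a ha => hgC a ?_, hgu⟩
    by_contra haD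
    refine hline a ha ?_
    have e1 : affinePerm T b '' ratLine p d = ratLine u (z - u) := by
      rw [image_affinePerm_ratLine]
      refine ratLine_eq_of_mem ?_ ?_ huz
      · rw [← image_affinePerm_ratLine, ← h₁]
        exact Set.mem_image_of_mem _ (hDL _ hj₁)
      · rw [← image_affinePerm_ratLine, ← h₂]
        exact Set.mem_image_of_mem _ (hDL _ hj₂)
    rw [← e1]
    obtain ⟨a', rfl⟩ := (affinePerm T b).surjective a
    exact Set.mem_image_of_mem _ (hDL _ fun h => haD (Set.mem_image_of_mem _ h))
  obtain ⟨z, hz⟩ := exists_notMem_ratLines hdim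
    ((insert (x + d) A).image (fun a => (x, a - x)) ∪ (insert (y + d) A).image fun a => (y, a - y))
  have aux : ∀ u : V, u ∉ A → (∀ a ∈ insert (u + d) A, z ∉ ratLine u (a - u)) →
      u ≠ z ∧ ∀ a ∈ A, a ∉ ratLine u (z - u) := by
    intro u hu hzu
    have huz : u ≠ z := by
      rintro rfl
      exact hzu _ (Finset.mem_insert_self _ _) (base_mem_ratLine _ _)
    refine ⟨huz, fun a ha haL => hzu a (Finset.mem_insert_of_mem ha) ?_⟩
    rw [← ratLine_eq_of_mem (base_mem_ratLine u (z - u)) haL (fun h => hu (h ▸ ha))]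
    exact mem_ratLine_sub u z
  have hzx := aux x hx fun a ha => hz (x, a - x)
    (Finset.mem_union_left _ (Finset.mem_image_of_mem (fun a => (x, a - x)) ha))
  have hzy := aux y hy fun a ha => hz (y, a - y)
    (Finset.mem_union_right _ (Finset.mem_image_of_mem (fun a => (y, a - y)) ha))
  obtain ⟨g, hg, hgA, hgx⟩ := step x z hx hzx.1 hzx.2
  obtain ⟨g', hg', hgA', hgy⟩ := step y z hy hzy.1 hzy.2
  refine ⟨g'⁻¹ * g, G.mul_mem (G.inv_mem hg') hg, fun a ha => ?_, ?_⟩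
  · rw [Equiv.Perm.mul_apply, hgA a ha, Equiv.Perm.inv_eq_iff_eq, hgA' a ha]
  · rw [Equiv.Perm.mul_apply, hgx, Equiv.Perm.inv_eq_iff_eq, hgy]

end Closure

section Exchange

variable {V : Type*} [AddCommGroup V] [Module ℚ V] [DecidableEq V] {G : Subgroup (Equiv.Perm V)}

/-- The exchange property for `curveClosure`. -/
theorem curveClosure_exchange (hdim : ∀ d : V, ∃ v, ∀ t : ℚ, v ≠ t • d) (hG : ContainsAffine G)
    (hN : NoCurveCover G) {j : ℕ} (hj : IsTransitiveOn G (j + 1)) {T : Finset V} (hT : T.card = j)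
    {a b : V} (ha : a ∉ T) (hab : a ∈ curveClosure G (insert b T : Finset V)) :
    b ∈ curveClosure G (insert a T : Finset V) := by
  by_contra hb
  have total : ∀ F : Finset V, F.card = j → ∀ x y, x ∉ F →
      y ∉ curveClosure G (insert x F : Finset V) → x ∈ curveClosure G (insert y F : Finset V) := by
    intro F hF x y hx hy
    obtain ⟨g, hg, hgT, hga⟩ := hj.exists_image_eq_apply_eq hT hF ha hx
    have hgb : g b ∉ curveClosure G (insert x F : Finset V) := by
      intro h
      rw [Finset.coe_insert, ← hga, ← hgT, ← Set.image_insert_eq, curveClosure_image hg,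
        Function.Injective.mem_set_image g.injective, ← Finset.coe_insert] at h
      exact hb h
    obtain ⟨g', hg', hfix, hgy⟩ := exists_fixing_of_notMem_curveClosure hG hN hgb hy
    have h := apply_mem_curveClosure hg' (apply_mem_curveClosure hg hab)
    have hF' : g' '' (F : Set V) = F := by
      have : Set.EqOn g' id (F : Set V) := fun c hc => hfix c (by simp [Finset.mem_coe.mp hc])
      rw [this.image_eq, Set.image_id]
    rw [Finset.coe_insert, Set.image_insert_eq, hgT, hga, Set.image_insert_eq, hgy,
      hfix x (by simp), hF', ← Finset.coe_insert] at h
    exact h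
  have nested : ∀ C C', IsCurve G C → IsCurve G C' → ∀ F : Finset V, F.card = j →
      (F : Set V) ⊆ C → (F : Set V) ⊆ C' → C ⊆ C' ∨ C' ⊆ C := by
    intro C C' hC hC' F hF hFC hFC'
    by_contra! h
    obtain ⟨⟨x, hxC, hxC'⟩, ⟨y, hyC', hyC⟩⟩ :=
      And.intro (Set.not_subset.mp h.1) (Set.not_subset.mp h.2)
    have hins : ∀ {u : V} {D : Set V}, u ∈ D → (F : Set V) ⊆ D →
        ((insert u F : Finset V) : Set V) ⊆ D := by
      intro u D hu hF
      rw [Finset.coe_insert]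
      exact Set.insert_subset hu hF
    exact hxC' (total F hF x y (fun hx => hxC' (hFC' hx)) (fun hy => hyC (hy C hC (hins hxC hFC)))
      C' hC' (hins hyC' hFC'))
  obtain ⟨d, hd⟩ := hdim 0
  have hd0 : d ≠ 0 := by simpa using hd 0
  obtain ⟨y, hy⟩ := exists_notMem_ratLine hdim 0 d
  have hLinf := infinite_ratLine 0 hd0
  obtain ⟨A, hAL, hA⟩ := hLinf.exists_subset_card_eq (j + 1)
  obtain ⟨x, hx⟩ : A.Nonempty := Finset.card_pos.mp (by omega)
  have hFL : ((A.erase x : Finset V) : Set V) ⊆ ratLine 0 d :=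
    (Finset.coe_subset.mpr (Finset.erase_subset x A)).trans hAL
  have hF : (A.erase x).card = j := by rw [Finset.card_erase_of_mem hx, hA]; rfl
  have hyF : y ∉ A.erase x := fun h => hy (hFL h)
  obtain ⟨g, hg, hgA⟩ := hj.exists_image_eq hA
    (show (insert y (A.erase x)).card = j + 1 by rw [Finset.card_insert_of_notMem hyF, hF])
  have hC : IsCurve G (g '' ratLine 0 d) := (isCurve_ratLine 0 hd0).image hg
  generalize hCdef : g '' ratLine 0 d = C at hC
  have hAC : ((insert y (A.erase x) : Finset V) : Set V) ⊆ C := by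
    rw [← hgA, ← hCdef]
    exact Set.image_mono hAL
  rw [Finset.coe_insert] at hAC
  have hyC : y ∈ C := hAC (Set.mem_insert _ _)
  have hFC := (Set.subset_insert _ _).trans hAC
  have hLC : ratLine 0 d ⊆ C :=
    (nested _ _ (isCurve_ratLine 0 hd0) hC _ hF hFL hFC).resolve_right fun h => hy (h hyC)
  obtain ⟨z, hz⟩ := hC.exists_notMem hdim
  have hzL : z ∉ ratLine 0 d := fun h => hz (hLC h)
  have hzy : z ≠ y := fun h => hz (h ▸ hyC)
  obtain ⟨φ, hφd, hφ⟩ := exists_functional_of_notMem_ratLine 0 d ![z, y] (by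
    intro i
    fin_cases i
    · exact hzL
    · exact hy)
  obtain ⟨T, b, hfix, hT, hcase⟩ := exists_affinePerm_fixing_ratLine hzy φ hφd (hφ 0) (hφ 1)
  have hsub : affinePerm T b '' C ⊆ C := by
    refine (nested _ _ (hC.image (hG T b)) hC _ hF ?_ hFC).resolve_right ?_
    · intro c hc
      exact ⟨c, hFC hc, hfix c (hFL hc)⟩
    · intro h
      obtain ⟨c, hc, hcy⟩ := h hyC
      rw [← hT] at hcy
      exact hz ((affinePerm T b).injective hcy ▸ hc)
  rcases hcase with ⟨-, h⟩ | h
  · exact hz (hsub ⟨y, hyC, h⟩)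
  · have hinf := h C hyC fun c hc => hsub (Set.mem_image_of_mem _ hc)
    obtain ⟨B, hB, hBj⟩ := hinf.exists_subset_card_eq j
    have hCM : C ⊆ ratLine z (y - z) :=
      (nested _ _ hC (isCurve_ratLine z (sub_ne_zero.mpr hzy.symm)) B hBj
        (hB.trans Set.inter_subset_left) (hB.trans Set.inter_subset_right)).resolve_right
        fun h => hz (h (base_mem_ratLine _ _))
    have hdL : d ∈ ratLine 0 d := by simpa using mem_ratLine_sub 0 d
    have hL := ratLine_eq_of_mem_of_mem (base_mem_ratLine 0 d) hdL
      (hCM (hLC (base_mem_ratLine 0 d))) (hCM (hLC hdL)) hd0.symm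
    exact hzL (hL ▸ base_mem_ratLine _ _)

/-- A closed set is the closure of any of its subsets of the right size. -/
theorem curveClosure_eq_of_subset (hdim : ∀ d : V, ∃ v, ∀ t : ℚ, v ≠ t • d)
    (hG : ContainsAffine G) (hN : NoCurveCover G) {k : ℕ} (hk : IsTransitiveOn G k)
    {A B : Finset V} (hA : A.card = k) (hB : B.card = k)
    (hBA : (B : Set V) ⊆ curveClosure G A) : curveClosure G B = curveClosure G A := by
  induction h : (B \ A).card generalizing A with
  | zero =>
    have : B ⊆ A := by simpa using h
    rw [Finset.eq_of_subset_of_card_le this (by rw [hA, hB])]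
  | succ n ih =>
    obtain ⟨y, hy⟩ : (B \ A).Nonempty := Finset.card_pos.mp (by omega)
    obtain ⟨hyB, hyA⟩ := Finset.mem_sdiff.mp hy
    obtain ⟨x, hx⟩ : (A \ B).Nonempty := by
      rw [← Finset.card_pos, Finset.card_sdiff_comm (hA.trans hB.symm)]
      omega
    obtain ⟨hxA, hxB⟩ := Finset.mem_sdiff.mp hx
    have hk0 : 0 < A.card := Finset.card_pos.mpr ⟨x, hxA⟩
    have hcard : (A.erase x).card = k - 1 := by rw [Finset.card_erase_of_mem hxA, hA]
    have hk' : IsTransitiveOn G (k - 1 + 1) := by rwa [show k - 1 + 1 = k by omega]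
    have hye : y ∉ A.erase x := fun h => hyA (Finset.mem_of_mem_erase h)
    have hex := curveClosure_exchange hdim hG hN hk' hcard hye (b := x)
      (by rw [Finset.insert_erase hxA]; exact hBA hyB)
    have hAA' : curveClosure G (insert y (A.erase x) : Finset V) = curveClosure G A := by
      refine Set.Subset.antisymm (curveClosure_mono ?_) (curveClosure_mono ?_)
      · rw [Finset.coe_insert]
        exact Set.insert_subset (hBA hyB) fun c hc =>
          subset_curveClosure _ (Finset.mem_of_mem_erase hc)
      · intro c hc
        by_cases hcx : c = x
        · rw [hcx]; exact hex
        · exact subset_curveClosure _ (by simp [hcx, Finset.mem_coe.mp hc])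
    rw [← hAA']
    refine ih ?_ (by rwa [hAA']) ?_
    · rw [Finset.card_insert_of_notMem hye, hcard]; omega
    · have : B \ insert y (A.erase x) = (B \ A).erase y := by
        ext c
        simp only [Finset.mem_sdiff, Finset.mem_insert, Finset.mem_erase, not_or, not_and]
        constructor
        · rintro ⟨h1, h2, h3⟩
          exact ⟨h2, h1, h3 fun h => hxB (h ▸ h1)⟩
        · rintro ⟨h1, h2, h3⟩
          exact ⟨h2, h1, fun _ => h3⟩
      rw [this, Finset.card_erase_of_mem hy, h]
      rfl

end Exchange

section Closures

variable {V : Type*} [AddCommGroup V] [Module ℚ V] [DecidableEq V] {G : Subgroup (Equiv.Perm V)}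

omit [DecidableEq V] in
theorem curveClosure_subset_of_card_le_one (hdim : ∀ d : V, ∃ v, ∀ t : ℚ, v ≠ t • d)
    {A : Finset V} (hA : A.card ≤ 1) : curveClosure G (A : Set V) ⊆ A := by
  intro x hx
  by_contra hxA
  obtain ⟨a, ha, hAa⟩ : ∃ a, x ≠ a ∧ (A : Set V) ⊆ {a} := by
    rcases Finset.card_le_one_iff_subset_singleton.mp hA with ⟨b, hb⟩
    rcases Finset.subset_singleton_iff.mp hb with rfl | rfl
    · obtain ⟨d, hd⟩ := hdim 0
      have hd0 : d ≠ 0 := by simpa using hd 0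
      exact ⟨x + d, by simpa using hd0, by simp⟩
    · exact ⟨b, by simpa using hxA, by simp⟩
  obtain ⟨v, hv⟩ := hdim (x - a)
  have hv0 : v ≠ 0 := by simpa using hv 0
  obtain ⟨t, ht⟩ := hx _ (isCurve_ratLine a hv0)
    (hAa.trans (Set.singleton_subset_iff.mpr (base_mem_ratLine a v)))
  have ht0 : t ≠ 0 := by
    rintro rfl
    exact ha (by simpa using ht)
  refine hv t⁻¹ ?_
  rw [ht, add_sub_cancel_left, smul_smul, inv_mul_cancel₀ ht0, one_smul]

theorem eq_univ_of_closed {K : Set ℚ} (h0 : 0 ∈ K)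
    (hmul : ∀ s ∈ K, ∀ t ∈ K, s * t ∈ K) (hinv : ∀ t ∈ K, t ≠ 0 → t⁻¹ ∈ K)
    (hsub : ∀ t ∈ K, 1 - t ∈ K) {x : ℚ} (hx : x ∈ K) (hx0 : x ≠ 0) (hx1 : x ≠ 1) (q : ℚ) :
    q ∈ K := by
  have hneg : (-1 : ℚ) ∈ K := by
    have h1x : 1 - x ≠ 0 := sub_ne_zero.mpr hx1.symm
    have := hmul _ (hmul _ (hsub _ (hinv x hx hx0)) _ (hinv _ (hsub x hx) h1x)) _ hx
    convert this using 1
    field_simp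
    ring
  have hnat : ∀ n : ℕ, (n : ℚ) ∈ K := by
    intro n
    induction n with
    | zero => simpa using h0
    | succ n ih =>
      have := hsub _ (hmul _ hneg _ ih)
      convert this using 1
      push_cast
      ring
  have hint : ∀ n : ℤ, (n : ℚ) ∈ K := by
    intro n
    obtain ⟨m, rfl | rfl⟩ := Int.eq_nat_or_neg n
    · exact_mod_cast hnat m
    · simpa using hmul _ hneg _ (hnat m)
  have := hmul _ (hint q.num) _ (hinv _ (hnat q.den) (by exact_mod_cast q.den_nz))
  rwa [← div_eq_mul_inv, Rat.num_div_den] at this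

theorem curveClosure_pair_eq (hdim : ∀ d : V, ∃ v, ∀ t : ℚ, v ≠ t • d) (hG : ContainsAffine G)
    (hN : NoCurveCover G) (hk : IsTransitiveOn G 2) {a b x y : V} (hab : a ≠ b) (hxy : x ≠ y)
    (hx : x ∈ curveClosure G {a, b}) (hy : y ∈ curveClosure G {a, b}) :
    curveClosure G {x, y} = curveClosure G {a, b} := by
  have := curveClosure_eq_of_subset hdim hG hN hk (Finset.card_pair hab) (Finset.card_pair hxy)
  rw [Finset.coe_pair, Finset.coe_pair] at this
  exact this (Set.insert_subset hx (Set.singleton_subset_iff.mpr hy))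

theorem ratLine_subset_curveClosure_pair (hdim : ∀ d : V, ∃ v, ∀ t : ℚ, v ≠ t • d)
    (hG : ContainsAffine G) (hN : NoCurveCover G) (hk : IsTransitiveOn G 2)
    (hnt : ∀ A : Finset V, A.card = 2 → ∃ x ∈ curveClosure G (A : Set V), x ∉ A)
    (a : V) {d : V} (hd : d ≠ 0) : ratLine a d ⊆ curveClosure G {a, a + d} := by
  have hscale : ∀ c : ℚ, c ≠ 0 → ∀ s : ℚ, ∀ e : V, s • e ∈ curveClosure G {0, e} →
      (c * s) • e ∈ curveClosure G {0, c • e} := by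
    intro c hc s e hs
    have := apply_mem_curveClosure (hG (LinearEquiv.smulOfNeZero ℚ V c hc) 0) hs
    rw [Set.image_pair] at this
    simpa [smul_smul, mul_comm] using this
  have h0 : (0 : V) ∈ curveClosure G {0, d} := subset_curveClosure _ (by simp)
  have hpair : ∀ t : ℚ, t ≠ 0 → t • d ∈ curveClosure G {0, d} →
      curveClosure G {0, t • d} = curveClosure G {0, d} := fun t ht h =>
    curveClosure_pair_eq hdim hG hN hk hd.symm (smul_ne_zero ht hd).symm h0 h
  have hd1 : d ∈ curveClosure G {0, d} := subset_curveClosure _ (by simp)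
  have hK : ∀ q : ℚ, q • d ∈ curveClosure G {0, d} := by
    obtain ⟨x, hx, hxA⟩ := hnt {0, d} (Finset.card_pair hd.symm)
    rw [Finset.coe_pair] at hx
    have hxL : x ∈ ratLine 0 d := hx _ (isCurve_ratLine 0 hd) (by
      rintro c (rfl | rfl)
      · exact base_mem_ratLine _ _
      · simpa using mem_ratLine_sub 0 c)
    obtain ⟨r, rfl⟩ := hxL
    rw [zero_add] at hx hxA
    refine eq_univ_of_closed (K := {q : ℚ | q • d ∈ curveClosure G {0, d}}) (by simpa using h0)
      ?_ ?_ ?_ hx ?_ ?_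
    · intro s hs t ht
      by_cases hs0 : s = 0
      · simpa [hs0] using h0
      · have := hscale s hs0 t d ht
        rwa [hpair s hs0 hs] at this
    · intro t ht ht0
      have h : t⁻¹ • (t • d) ∈ curveClosure G {0, t • d} := by
        rw [hpair t ht0 ht, smul_smul, inv_mul_cancel₀ ht0, one_smul]
        exact hd1
      have := hscale t⁻¹ (inv_ne_zero ht0) t⁻¹ (t • d) h
      rwa [smul_smul, smul_smul, inv_mul_cancel₀ ht0, one_smul, mul_assoc, inv_mul_cancel₀ ht0,
        mul_one] at this
    · intro t ht
      have := apply_mem_curveClosure (hG (LinearEquiv.neg ℚ) d) ht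
      rw [Set.image_pair] at this
      have e : -(t • d) + d = (1 - t) • d := by module
      simpa [Set.pair_comm, e] using this
    · rintro rfl
      simp at hxA
    · rintro rfl
      simp at hxA
  rintro _ ⟨t, rfl⟩
  have := apply_mem_curveClosure (hG (LinearEquiv.refl ℚ V) a) (hK t)
  rw [Set.image_pair] at this
  simpa [add_comm] using this

theorem mapsLines_of_curveClosure_pair (hdim : ∀ d : V, ∃ v, ∀ t : ℚ, v ≠ t • d)
    (hG : ContainsAffine G) (hN : NoCurveCover G) (hk : IsTransitiveOn G 2)
    (hnt : ∀ A : Finset V, A.card = 2 → ∃ x ∈ curveClosure G (A : Set V), x ∉ A)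
    {g : Equiv.Perm V} (hg : g ∈ G) : MapsLines g := by
  intro a d hd t
  have h := apply_mem_curveClosure hg
    (ratLine_subset_curveClosure_pair hdim hG hN hk hnt a hd (add_smul_mem_ratLine a d t))
  rw [Set.image_pair] at h
  refine h _ (isCurve_ratLine _ (sub_ne_zero.mpr fun h => hd ?_)) ?_
  · simpa using g.injective h
  · rintro c (rfl | rfl)
    · exact base_mem_ratLine _ _
    · exact mem_ratLine_sub _ _

theorem exists_eq_affinePerm_of_curveClosure_pair (hdim : ∀ d : V, ∃ v, ∀ t : ℚ, v ≠ t • d)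
    (hG : ContainsAffine G) (hN : NoCurveCover G) (hk : IsTransitiveOn G 2)
    (hnt : ∀ A : Finset V, A.card = 2 → ∃ x ∈ curveClosure G (A : Set V), x ∉ A)
    {g : Equiv.Perm V} (hg : g ∈ G) : ∃ (T : V ≃ₗ[ℚ] V) (b : V), ∀ x, g x = T x + b := by
  have hmem : affinePerm (LinearEquiv.refl ℚ V) (-g 0) * g ∈ G := G.mul_mem (hG _ _) hg
  obtain ⟨T, hT⟩ := MapsLines.exists_eq_affinePerm hdim
    (mapsLines_of_curveClosure_pair hdim hG hN hk hnt hmem)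
    (mapsLines_of_curveClosure_pair hdim hG hN hk hnt (G.inv_mem hmem)) (by simp)
  refine ⟨T, g 0, fun x => ?_⟩
  rw [← hT]
  simp

/-- For `k ≥ 3`, closures of `k`-sets have at most one additional point. -/
theorem eq_of_mem_curveClosure_of_notMem (hdim : ∀ d : V, ∃ v, ∀ t : ℚ, v ≠ t • d)
    (hG : ContainsAffine G) (hN : NoCurveCover G) {k : ℕ} (hk3 : 3 ≤ k) (hk : IsTransitiveOn G k)
    {A : Finset V} (hA : A.card = k) {z w : V} (hz : z ∈ curveClosure G (A : Set V)) (hzA : z ∉ A)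
    (hw : w ∈ curveClosure G (A : Set V)) (hwA : w ∉ A) : z = w := by
  obtain ⟨d, hd⟩ := hdim 0
  have hd0 : d ≠ 0 := by simpa using hd 0
  obtain ⟨y, hy⟩ := exists_notMem_ratLine hdim 0 d
  obtain ⟨T, hTL, hT⟩ := (infinite_ratLine 0 hd0).exists_subset_card_eq (k - 1)
  have hcard : ∀ u, u ∉ ratLine 0 d → (insert u T).card = k := by
    intro u hu
    rw [Finset.card_insert_of_notMem fun h => hu (hTL h), hT]
    omega
  -- move `A` to a set with all but one of its points on a line
  obtain ⟨g, hg, hgA⟩ := hk.exists_image_eq hA (hcard y hy)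
  have himg : ∀ u, u ∈ curveClosure G (A : Set V) → u ∉ A →
      g u ∈ curveClosure G (insert y T : Finset V) ∧ g u ∉ insert y T := by
    intro u hu huA
    refine ⟨by rw [← hgA]; exact apply_mem_curveClosure hg hu, fun h => huA ?_⟩
    rw [← Finset.mem_coe, ← hgA, Function.Injective.mem_set_image g.injective] at h
    exact h
  obtain ⟨hz, hzA⟩ := himg z hz hzA
  obtain ⟨hw, hwA⟩ := himg w hw hwA
  refine g.injective ?_
  generalize g z = z at *
  generalize g w = w at *
  generalize hCdef : curveClosure G ((insert y T : Finset V) : Set V) = C at *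
  have hTC : (T : Set V) ⊆ C := by
    rw [← hCdef]
    exact fun c hc => subset_curveClosure _ (by simp [Finset.mem_coe.mp hc])
  have hyC : y ∈ C := by
    rw [← hCdef]
    exact subset_curveClosure _ (by simp)
  have hcl : ∀ B : Finset V, B.card = k → (B : Set V) ⊆ C → curveClosure G (B : Set V) = C := by
    intro B hB hBC
    rw [← hCdef] at hBC ⊢
    exact curveClosure_eq_of_subset hdim hG hN hk (hcard y hy) hB hBC
  have hins : ∀ u ∈ C, ((insert u T : Finset V) : Set V) ⊆ C := by
    intro u hu
    rw [Finset.coe_insert]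
    exact Set.insert_subset hu hTC
  have hoff : ∀ u ∈ C, u ∉ insert y T → u ∉ ratLine 0 d := by
    intro u hu huA huL
    refine hy ?_
    have hB : (insert u T).card = k := by
      rw [Finset.card_insert_of_notMem fun h => huA (Finset.mem_insert_of_mem h), hT]
      omega
    rw [← hcl _ hB (hins u hu)] at hyC
    refine hyC _ (isCurve_ratLine 0 hd0) ?_
    rw [Finset.coe_insert]
    exact Set.insert_subset huL hTL
  have hzL := hoff z hz hzA
  have hwL := hoff w hw hwA
  obtain ⟨φ, hφd, hφ⟩ := exists_functional_of_notMem_ratLine 0 d ![y, z, w] (by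
    intro i
    fin_cases i
    · exact hy
    · exact hzL
    · exact hwL)
  have hneg : ∀ u v, u ∈ C → v ∈ C → u ≠ v → u ∉ ratLine 0 d → v ∉ ratLine 0 d →
      φ (u - 0) ≠ 0 → φ (v - 0) ≠ 0 → φ (v - 0) = -φ (u - 0) := by
    intro u v hu hv huv huL hvL hφu hφv
    obtain ⟨S, b, hfix, hS, ⟨h, -⟩ | h⟩ := exists_affinePerm_fixing_ratLine huv φ hφd hφu hφv
    · exact h
    exfalso
    have hST : affinePerm S b '' (T : Set V) = T := by
      have : Set.EqOn (affinePerm S b) id (T : Set V) := fun c hc => hfix c (hTL hc)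
      rw [this.image_eq, Set.image_id]
    have hSC : affinePerm S b '' C = C := by
      conv_lhs => rw [← hcl _ (hcard u huL) (hins u hu)]
      rw [← curveClosure_image (hG S b), Finset.coe_insert, Set.image_insert_eq, hST, hS,
        ← Finset.coe_insert, hcl _ (hcard v hvL) (hins v hv)]
    have hinf := h C hv fun c hc => hSC ▸ Set.mem_image_of_mem _ hc
    obtain ⟨B, hB, hBk⟩ := hinf.exists_subset_card_eq k
    have hCM : C ⊆ ratLine u (v - u) := by
      rw [← hcl B hBk (hB.trans Set.inter_subset_left)]
      exact fun c hc => hc _ (isCurve_ratLine u (sub_ne_zero.mpr huv.symm))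
        (hB.trans Set.inter_subset_right)
    obtain ⟨t₁, ht₁, t₂, ht₂, ht⟩ := Finset.one_lt_card.mp (show 1 < T.card by omega)
    have hL := ratLine_eq_of_mem_of_mem (hTL ht₁) (hTL ht₂) (hCM (hTC ht₁)) (hCM (hTC ht₂)) ht
    exact huL (hL ▸ base_mem_ratLine _ _)
  by_contra hzw
  have hzy : y ≠ z := fun h => hzA (by simp [h])
  have hwy : y ≠ w := fun h => hwA (by simp [h])
  have hφy : φ (y - 0) ≠ 0 := hφ 0
  have hφz : φ (z - 0) ≠ 0 := hφ 1
  have hφw : φ (w - 0) ≠ 0 := hφ 2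
  have e1 := hneg y z hyC hz hzy hy hzL hφy hφz
  have e2 := hneg y w hyC hw hwy hy hwL hφy hφw
  have e3 := hneg z w hz hw hzw hzL hwL hφz hφw
  exact hφz (by linarith)

/-- For `k ≥ 3`, closures of `k`-sets are trivial. -/
theorem exists_curveClosure_subset (hdim : ∀ d : V, ∃ v, ∀ t : ℚ, v ≠ t • d)
    (hG : ContainsAffine G) (hN : NoCurveCover G) {k : ℕ} (hk3 : 3 ≤ k)
    (hk : IsTransitiveOn G k) :
    ∃ A : Finset V, A.card = k ∧ curveClosure G (A : Set V) ⊆ A := by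
  by_contra! hcon
  obtain ⟨d, hd⟩ := hdim 0
  have hd0 : d ≠ 0 := by simpa using hd 0
  have hinjQ : Function.Injective fun t : ℚ => t • d := smul_left_injective ℚ hd0
  have hinj : Function.Injective fun i : ℤ => (i : ℚ) • d := hinjQ.comp Int.cast_injective
  have hcard : ∀ S : Finset ℤ, S.card = k → (S.image fun i : ℤ => (i : ℚ) • d).card = k :=
    fun S hS => by rw [Finset.card_image_of_injective _ hinj, hS]
  -- the additional point of a symmetric set of collinear points is its centre
  have hsymm : ∀ (S : Finset ℤ) (a : ℤ), S.card = k → (∀ i ∈ S, a - i ∈ S) →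
      ((a : ℚ) / 2) • d ∈ curveClosure G (S.image fun i : ℤ => (i : ℚ) • d : Finset V) ∧
      ((a : ℚ) / 2) • d ∉ S.image fun i : ℤ => (i : ℚ) • d := by
    intro S a hS hSa
    have hSk := hcard S hS
    generalize hA : (S.image fun i : ℤ => (i : ℚ) • d) = A at hSk
    obtain ⟨z, hz, hzA⟩ := Set.not_subset.mp (hcon A hSk)
    have hρA : affinePerm (LinearEquiv.neg ℚ) ((a : ℚ) • d) '' (A : Set V) = A := by
      rw [← Finset.coe_image, Finset.coe_inj]
      refine Finset.eq_of_subset_of_card_le ?_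
        (Finset.card_image_of_injective _ (Equiv.injective _)).ge
      rw [← hA, Finset.image_image]
      intro c hc
      obtain ⟨i, hi, rfl⟩ := Finset.mem_image.mp hc
      refine Finset.mem_image.mpr ⟨a - i, hSa i hi, ?_⟩
      simp
      module
    have hρz := apply_mem_curveClosure (hG (LinearEquiv.neg ℚ) ((a : ℚ) • d)) hz
    rw [hρA] at hρz
    have hρzA : affinePerm (LinearEquiv.neg ℚ) ((a : ℚ) • d) z ∉ A := by
      intro h
      rw [← Finset.mem_coe, ← hρA, Function.Injective.mem_set_image (Equiv.injective _)] at h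
      exact hzA h
    have h := eq_of_mem_curveClosure_of_notMem hdim hG hN hk3 hk hSk hz hzA hρz hρzA
    have hz' : z = ((a : ℚ) / 2) • d := by
      have h2 : z + z = (a : ℚ) • d := by
        nth_rewrite 2 [h]
        simp
      have h3 : z = (1 / 2 : ℚ) • (z + z) := by module
      rw [h3, h2, smul_smul]
      congr 1
      ring
    rw [← hz']
    exact ⟨hz, hzA⟩
  obtain ⟨m, hm | hm⟩ := Nat.even_or_odd' k
  · obtain ⟨h₁, h₁'⟩ := hsymm ((Finset.Icc (-m : ℤ) m).erase 0) 0
      (by rw [Finset.card_erase_of_mem (by simp), Int.card_Icc]; omega)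
      (by intro i; simp only [Finset.mem_erase, Finset.mem_Icc]; omega)
    have hS₂ : (Finset.Icc (-m : ℤ) (m - 1)).card = k := by rw [Int.card_Icc]; omega
    obtain ⟨h₂, -⟩ := hsymm (Finset.Icc (-m : ℤ) (m - 1)) (-1) hS₂
      (by intro i; simp only [Finset.mem_Icc]; omega)
    have hS₁ : ((Finset.Icc (-m : ℤ) m).erase 0).card = k := by
      rw [Finset.card_erase_of_mem (by simp), Int.card_Icc]; omega
    rw [curveClosure_eq_of_subset hdim hG hN hk (hcard _ hS₁) (hcard _ hS₂)] at h₂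
    · have h := hinjQ (eq_of_mem_curveClosure_of_notMem hdim hG hN hk3 hk (hcard _ hS₁) h₁ h₁' h₂
        (by
          intro h
          obtain ⟨i, -, hi⟩ := Finset.mem_image.mp h
          have hi' : (i : ℚ) = ((-1 : ℤ) : ℚ) / 2 := hinjQ hi
          rw [eq_div_iff two_ne_zero] at hi'
          have : i * 2 = -1 := by exact_mod_cast hi'
          omega))
      norm_num at h
    · intro c hc
      obtain ⟨i, hi, rfl⟩ := Finset.mem_image.mp hc
      rw [Finset.mem_Icc] at hi
      by_cases hi0 : i = 0
      · simpa [hi0] using h₁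
      · refine subset_curveClosure _ (Finset.mem_coe.mpr (Finset.mem_image.mpr ⟨i, ?_, rfl⟩))
        rw [Finset.mem_erase, Finset.mem_Icc]
        omega
  · obtain ⟨-, h⟩ := hsymm (Finset.Icc (-m : ℤ) m) 0 (by rw [Int.card_Icc]; omega)
      (by intro i; simp only [Finset.mem_Icc]; omega)
    exact h (Finset.mem_image.mpr ⟨0, by simp, by simp⟩)

omit [DecidableEq V] in
/-- A group properly containing the affine group of a rational vector space of dimension at least
two is highly transitive. -/
theorem isTransitiveOn_of_containsAffine (hdim : ∀ d : V, ∃ v, ∀ t : ℚ, v ≠ t • d)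
    (hG : ContainsAffine G) (hproper : ∃ σ ∈ G, ¬ ∃ (T : V ≃ₗ[ℚ] V) (b : V), ∀ x, σ x = T x + b)
    (k : ℕ) : IsTransitiveOn G k := by
  classical
  induction k with
  | zero => exact isTransitiveOn_zero
  | succ k hk =>
    refine isTransitiveOn_succ hk fun A hA x y hx hy => ?_
    by_cases hN : NoCurveCover G
    swap
    · exact exists_fixing_of_not_noCurveCover hdim hG hN A hx hy
    obtain ⟨B, hB, hBcl⟩ : ∃ B : Finset V, B.card = k ∧ curveClosure G (B : Set V) ⊆ B := by
      rcases Nat.lt_or_ge 1 k with h1 | h1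
      · rcases Nat.lt_or_ge 2 k with h2 | h2
        · exact exists_curveClosure_subset hdim hG hN h2 hk
        · obtain rfl : k = 2 := by omega
          by_contra! hcon
          obtain ⟨σ, hσ, hσ'⟩ := hproper
          exact hσ' (exists_eq_affinePerm_of_curveClosure_pair hdim hG hN hk
            (fun B hB => Set.not_subset.mp (hcon B hB)) hσ)
      · exact ⟨A, hA, curveClosure_subset_of_card_le_one hdim (hA ▸ h1)⟩
    obtain ⟨g, hg, hgB⟩ := hk.exists_image_eq hB hA
    have hAcl : curveClosure G (A : Set V) ⊆ A := by
      rw [← hgB, curveClosure_image hg]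
      exact Set.image_mono hBcl
    exact exists_fixing_of_notMem_curveClosure hG hN (fun h => hx (hAcl h)) fun h => hy (hAcl h)

end Closures

/-- Any group of permutations of `ℚ^n` (for `n ≥ 2`) properly containing `AGL_n(ℚ)`
is highly transitive. -/
theorem agl_maximal_highly_transitive (n : ℕ) (hn : 2 ≤ n)
    (G : Subgroup (Equiv.Perm (Fin n → ℚ)))
    (hsub : ∀ σ : Equiv.Perm (Fin n → ℚ), IsAGL n σ → σ ∈ G)
    (hproper : ∃ σ ∈ G, ¬ IsAGL n σ) :
    ∀ k : ℕ, 1 ≤ k → ∀ f g : Fin k → (Fin n → ℚ),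
      Function.Injective f → Function.Injective g →
      ∃ σ ∈ G, ∀ i, σ (f i) = g i := by
  intro k _
  refine isTransitiveOn_of_containsAffine (G := G) ?_ (fun T b => hsub _ ⟨T, b, fun _ => rfl⟩)
    hproper k
  intro d
  by_contra! hcon
  let i₀ : Fin n := ⟨0, by omega⟩
  let i₁ : Fin n := ⟨1, by omega⟩
  have hne : i₁ ≠ i₀ := by simp [i₀, i₁]
  obtain ⟨s, hs⟩ := hcon (Pi.single i₀ 1)
  obtain ⟨t, ht⟩ := hcon (Pi.single i₁ 1)
  have h₀ := congrFun hs i₀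
  have h₁ := congrFun hs i₁
  have h₂ := congrFun ht i₁
  simp only [Pi.single_eq_same, Pi.smul_apply, smul_eq_mul, Pi.single_eq_of_ne hne] at h₀ h₁ h₂
  rcases mul_eq_zero.mp h₁.symm with h | h
  · rw [h, zero_mul] at h₀
    exact one_ne_zero h₀
  · rw [h, mul_zero] at h₂
    exact one_ne_zero h₂
end

section
/- Let n ≥ 3 be a natural number, let Ω = P(ℚ^n) be the projective space of one-dimensional subspaces of ℚ^n, and let PGL_n(ℚ) be the group of permutations of Ω induced by invertible ℚ-linear maps of ℚ^n. If G is a subgroup of the group of all permutations of Ω that properly contains PGL_n(ℚ), then G is highly transitive: for every k ≥ 1 and any two k-tuples of pairwise distinct points of Ω there is an element of G mapping the first tuple to the second. (This is the content of the maximality of PGL_n(ℚ) as a closed subgroup of S_ω.) -/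
/-- `σ` is an element of `PGL_n(ℚ)` acting on the projective space `P(ℚ^n)`:
a permutation of `P(ℚ^n)` induced by an invertible `ℚ`-linear map of `ℚ^n`. -/
def IsPGL (n : ℕ) (σ : Equiv.Perm (Projectivization ℚ (Fin n → ℚ))) : Prop :=
  ∃ T : (Fin n → ℚ) ≃ₗ[ℚ] (Fin n → ℚ), ∀ (v : Fin n → ℚ) (hv : v ≠ 0),
    σ (Projectivization.mk ℚ v hv) =
      Projectivization.mk ℚ (T v) (by simpa using hv)

open Projectivization

section Projective

variable {K V : Type*} [Field K] [AddCommGroup V] [Module K V]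

lemma Projectivization.rep_mk_mem_iff {U : Submodule K V} {v : V} (hv : v ≠ 0) :
    (Projectivization.mk K v hv).rep ∈ U ↔ v ∈ U := by
  obtain ⟨a, ha⟩ := Projectivization.exists_smul_eq_mk_rep K v hv
  rw [← ha, Units.smul_def, U.smul_mem_iff a.ne_zero]

lemma Projectivization.eq_of_rep_mem_span {p q : Projectivization K V}
    (h : p.rep ∈ Submodule.span K {q.rep}) : p = q := by
  rw [← p.mk_rep, ← q.mk_rep, Projectivization.mk_eq_mk_iff']
  exact Submodule.mem_span_singleton.1 h

lemma Projectivization.linearEquiv_smul_mk (T : V ≃ₗ[K] V) {v : V} (hv : v ≠ 0) :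
    T • Projectivization.mk K v hv = Projectivization.mk K (T v) (by simpa using hv) :=
  rfl

lemma Projectivization.rep_smul_mem_iff {U : Submodule K V} (T : V ≃ₗ[K] V)
    (p : Projectivization K V) : (T • p).rep ∈ U ↔ T p.rep ∈ U := by
  conv_lhs => rw [← p.mk_rep, Projectivization.linearEquiv_smul_mk]
  rw [Projectivization.rep_mk_mem_iff]

lemma Projectivization.smul_eq_of_apply_rep_mem_span {T : V ≃ₗ[K] V} {p q : Projectivization K V}
    (h : T p.rep ∈ Submodule.span K {q.rep}) : T • p = q :=
  Projectivization.eq_of_rep_mem_span ((Projectivization.rep_smul_mem_iff T p).2 h)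

/-- Two vectors outside a subspace are simultaneously detected by a functional vanishing on it. -/
lemma Submodule.exists_dual_ne_zero_pair {L : Submodule K V} {v w : V} (hv : v ∉ L) (hw : w ∉ L) :
    ∃ φ : V →ₗ[K] K, φ v ≠ 0 ∧ φ w ≠ 0 ∧ ∀ x ∈ L, φ x = 0 := by
  obtain ⟨φ, hφ, hφL⟩ := L.exists_le_ker_of_notMem hv
  obtain ⟨ψ, hψ, hψL⟩ := L.exists_le_ker_of_notMem hw
  by_cases h₁ : φ w = 0
  · by_cases h₂ : ψ v = 0
    · refine ⟨φ + ψ, by simpa [h₂] using hφ, by simpa [h₁] using hψ, fun x hx => ?_⟩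
      simp [LinearMap.mem_ker.1 (hφL hx), LinearMap.mem_ker.1 (hψL hx)]
    · exact ⟨ψ, h₂, hψ, fun x hx => hψL hx⟩
  · exact ⟨φ, hφ, h₁, fun x hx => hφL hx⟩

/-- Two points outside a subspace are exchanged by a reflection fixing that subspace. -/
lemma Projectivization.exists_smul_swap {L : Submodule K V} {p q : Projectivization K V}
    (hp : p.rep ∉ L) (hq : q.rep ∉ L) :
    ∃ T : V ≃ₗ[K] V, (∀ x : Projectivization K V, x.rep ∈ L → T • x = x) ∧ T • p = q ∧ T • q = p ∧
      ∀ U : Submodule K V, p.rep ∈ U → q.rep ∈ U →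
        ∀ x : Projectivization K V, x.rep ∈ U → (T • x).rep ∈ U := by
  obtain ⟨φ, hφp, hφq, hφL⟩ := Submodule.exists_dual_ne_zero_pair hp hq
  have h2 : ((φ p.rep)⁻¹ • φ) (p.rep + (φ p.rep / φ q.rep) • q.rep) = 2 := by
    simp only [LinearMap.smul_apply, map_add, map_smul, smul_eq_mul]
    field_simp
    norm_num
  refine ⟨Module.reflection h2, fun x hx => ?_, ?_, ?_, fun U hpU hqU x hx => ?_⟩
  · apply Projectivization.smul_eq_of_apply_rep_mem_span
    simp [Module.reflection_apply, hφL _ hx, Submodule.mem_span_singleton_self]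
  · apply Projectivization.smul_eq_of_apply_rep_mem_span
    rw [Submodule.mem_span_singleton]
    refine ⟨-(φ p.rep / φ q.rep), ?_⟩
    simp [Module.reflection_apply, hφp]
  · apply Projectivization.smul_eq_of_apply_rep_mem_span
    rw [Submodule.mem_span_singleton]
    refine ⟨-(φ q.rep / φ p.rep), ?_⟩
    simp only [Module.reflection_apply, LinearMap.smul_apply, smul_add, smul_smul, smul_eq_mul]
    match_scalars <;> field_simp
    norm_num
  · rw [Projectivization.rep_smul_mem_iff, Module.reflection_apply]
    exact U.sub_mem hx (U.smul_mem _ (U.add_mem hpU (U.smul_mem _ hqU)))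

/-- A vector outside a subspace can be rescaled by a linear automorphism fixing the subspace. -/
lemma Submodule.exists_linearEquiv_scale {L : Submodule K V} {v : V} (hv : v ∉ L) {c : K}
    (hc : c ≠ 0) : ∃ T : V ≃ₗ[K] V, T v = c • v ∧ ∀ x ∈ L, T x = x := by
  obtain ⟨φ, hφ, hφL⟩ := L.exists_le_ker_of_notMem hv
  have key : ∀ d : K, d ≠ 0 →
      (LinearMap.transvection φ (((d - 1) / φ v) • v)).comp
        (LinearMap.transvection φ (((d⁻¹ - 1) / φ v) • v)) = LinearMap.id := by
    intro d hd
    ext x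
    simp only [LinearMap.comp_apply, LinearMap.transvection.apply, map_add, map_smul,
      LinearMap.id_apply]
    match_scalars <;> field_simp
    ring
  refine ⟨LinearEquiv.ofLinearMap (LinearMap.transvection φ (((c - 1) / φ v) • v))
    (LinearMap.transvection φ (((c⁻¹ - 1) / φ v) • v)) (key c hc) ?_, ?_, fun x hx => ?_⟩
  · simpa using key c⁻¹ (inv_ne_zero hc)
  · simp only [LinearEquiv.coe_ofLinearMap, LinearMap.transvection.apply]
    match_scalars
    field_simp
    ring
  · have : φ x = 0 := hφL hx
    simp [LinearMap.transvection.apply, this]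

lemma Projectivization.infinite_setOf_rep_mem_span_pair [Infinite K] {u v : V} (hv : v ≠ 0)
    (hu : u ∉ Submodule.span K {v}) :
    {y : Projectivization K V | y.rep ∈ Submodule.span K {u, v}}.Infinite := by
  have huv : ∀ β γ : K, β • u + γ • v = 0 → β = 0 := by
    intro β γ h
    by_contra hβ
    refine hu (Submodule.mem_span_singleton.2 ⟨-(β⁻¹ * γ), ?_⟩)
    rw [← sub_eq_zero, ← smul_zero (-β⁻¹), ← h]
    match_scalars <;> field_simp
  have hne : ∀ t : K, u + t • v ≠ 0 := fun t h => one_ne_zero (huv 1 t (by simpa using h))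
  refine Set.infinite_of_injective_forall_mem
    (f := fun t : K => Projectivization.mk K (u + t • v) (hne t)) ?_ ?_
  · intro t s hts
    obtain ⟨c, hc⟩ := (Projectivization.mk_eq_mk_iff' K _ _ _ _).1 hts
    have h1 : c - 1 = 0 := huv (c - 1) (c * s - t) (by rw [← sub_eq_zero.2 hc]; module)
    have h2 : (s - t) • v = 0 := by
      rw [sub_eq_zero.1 h1, one_smul] at hc
      rw [← sub_eq_zero.2 hc]; module
    simpa [hv, sub_eq_zero, eq_comm] using h2
  · exact fun t => (rep_mk_mem_iff _).2 (Submodule.mem_span_pair.2 ⟨1, t, by simp⟩)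

lemma Projectivization.span_pair_eq_of_ne {p q : Projectivization K V} (hpq : p ≠ q) {u v : V}
    (hp : p.rep ∈ Submodule.span K {u, v}) (hq : q.rep ∈ Submodule.span K {u, v}) :
    Submodule.span K {p.rep, q.rep} = Submodule.span K {u, v} := by
  have := FiniteDimensional.span_of_finite K (Set.toFinite {u, v})
  refine Submodule.eq_of_le_of_finrank_le (Submodule.span_le.2 (Set.pair_subset hp hq)) ?_
  have hr : ∀ a b : V, Set.range ![a, b] = {a, b} := fun a b => by
    rw [Matrix.range_cons_cons_empty]
  have h1 := finrank_range_le_card (R := K) ![u, v]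
  have h2 := finrank_span_eq_card (linearIndependent_pair_iff_ne.2 hpq)
  rw [Set.finrank, hr] at h1
  rw [hr] at h2
  exact h1.trans h2.ge

/-- `G` acts transitively on the `k`-tuples of pairwise distinct elements of `X`. -/
def Subgroup.TupleTransitive {X : Type*} (G : Subgroup (Equiv.Perm X)) (k : ℕ) : Prop :=
  ∀ f g : Fin k → X, Function.Injective f → Function.Injective g → ∃ σ ∈ G, ∀ i, σ (f i) = g i

lemma Subgroup.TupleTransitive.exists_fixing {X : Type*} {G : Subgroup (Equiv.Perm X)}
    {F : Finset X} (hG : G.TupleTransitive (F.card + 1)) {a b : X} (ha : a ∉ F) (hb : b ∉ F) :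
    ∃ σ ∈ G, (∀ x ∈ F, σ x = x) ∧ σ a = b := by
  have hinj : ∀ c ∉ F, Function.Injective
      (Fin.snoc (fun i => (F.equivFin.symm i : X)) c : Fin (F.card + 1) → X) := by
    intro c hc
    rw [Fin.snoc_injective_iff]
    refine ⟨Subtype.val_injective.comp F.equivFin.symm.injective, ?_⟩
    rintro ⟨i, rfl⟩
    exact hc (F.equivFin.symm i).2
  obtain ⟨σ, hσ, h⟩ := hG _ _ (hinj a ha) (hinj b hb)
  refine ⟨σ, hσ, fun x hx => ?_, by simpa using h (Fin.last _)⟩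
  simpa using h (F.equivFin ⟨x, hx⟩).castSucc

lemma Subgroup.TupleTransitive.exists_image_eq {X : Type*} [DecidableEq X]
    {G : Subgroup (Equiv.Perm X)} {F F' : Finset X}
    (hG : G.TupleTransitive F.card) (h : F'.card = F.card) :
    ∃ σ ∈ G, F.image σ = F' := by
  obtain ⟨σ, hσ, hs⟩ := hG (fun i => F.equivFin.symm i) (fun i => (F'.equivFinOfCardEq h).symm i)
    (Subtype.val_injective.comp (Equiv.injective _))
    (Subtype.val_injective.comp (Equiv.injective _))
  refine ⟨σ, hσ, Finset.eq_of_subset_of_card_le ?_ ?_⟩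
  · intro y hy
    obtain ⟨x, hx, rfl⟩ := Finset.mem_image.1 hy
    have := hs (F.equivFin ⟨x, hx⟩)
    simp only [Equiv.symm_apply_apply] at this
    rw [this]
    exact Subtype.property _
  · rw [h, Finset.card_image_of_injective _ σ.injective]

/-- The points that every element of `G` maps into the linear span of the image of `F`. -/
def Projectivization.spanClosure (G : Subgroup (Equiv.Perm (Projectivization K V)))
    (F : Set (Projectivization K V)) : Set (Projectivization K V) :=
  {a | ∀ g ∈ G, (g a).rep ∈ Submodule.span K ((fun x => (g x).rep) '' F)}

section SpanClosure

variable {G : Subgroup (Equiv.Perm (Projectivization K V))} {F F' : Set (Projectivization K V)}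

lemma Projectivization.subset_spanClosure : F ⊆ spanClosure G F :=
  fun x hx _ _ => Submodule.subset_span ⟨x, hx, rfl⟩

lemma Projectivization.spanClosure_subset (h : F ⊆ spanClosure G F') :
    spanClosure G F ⊆ spanClosure G F' := by
  intro a ha g hg
  refine Submodule.span_le.2 ?_ (ha g hg)
  rintro _ ⟨x, hx, rfl⟩
  exact h hx g hg

lemma Projectivization.apply_mem_spanClosure {g : Equiv.Perm (Projectivization K V)} (hg : g ∈ G)
    {a : Projectivization K V} (ha : a ∈ spanClosure G F) : g a ∈ spanClosure G (g '' F) := by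
  intro h hh
  simpa [Set.image_image] using ha (h * g) (G.mul_mem hh hg)

lemma Projectivization.rep_mem_of_mem_spanClosure {U : Submodule K V} (h : ∀ x ∈ F, x.rep ∈ U)
    {a : Projectivization K V} (ha : a ∈ spanClosure G F) : a.rep ∈ U := by
  refine Submodule.span_le.2 ?_ (ha 1 G.one_mem)
  rintro _ ⟨x, hx, rfl⟩
  exact h x hx

end SpanClosure

section Transitivity

variable {G : Subgroup (Equiv.Perm (Projectivization K V))}

lemma Projectivization.exists_mem_swap
    (hG : ∀ T : V ≃ₗ[K] V, MulAction.toPerm T ∈ G) {L : Submodule K V}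
    {p q : Projectivization K V} (hp : p.rep ∉ L) (hq : q.rep ∉ L) :
    ∃ r ∈ G, (∀ x : Projectivization K V, x.rep ∈ L → r x = x) ∧ r p = q ∧ r q = p ∧
      ∀ U : Submodule K V, p.rep ∈ U → q.rep ∈ U →
        ∀ x : Projectivization K V, x.rep ∈ U → (r x).rep ∈ U := by
  obtain ⟨T, h⟩ := exists_smul_swap hp hq
  exact ⟨_, hG T, h⟩

lemma Projectivization.mem_of_mem_spanClosure_insert
    (hG : ∀ T : V ≃ₗ[K] V, MulAction.toPerm T ∈ G) {L : Submodule K V}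
    {F : Finset (Projectivization K V)} (hk : G.TupleTransitive (F.card + 1))
    (hF : ∀ x ∈ F, x.rep ∈ L) {p a : Projectivization K V} (hp : p.rep ∉ L) (ha : a.rep ∈ L)
    (hap : a ∈ spanClosure G (insert p (F : Set (Projectivization K V)))) : a ∈ F := by
  by_contra haF
  have hcl : ∀ q : Projectivization K V, q.rep ∉ L →
      a ∈ spanClosure G (insert q (F : Set (Projectivization K V))) := by
    intro q hq
    obtain ⟨r, hr, hrL, hrp, -, -⟩ := exists_mem_swap hG hp hq
    have := apply_mem_spanClosure hr hap
    rw [hrL a ha, Set.image_insert_eq, hrp] at this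
    rwa [Set.image_congr (g := id) (fun x hx => hrL x (hF x hx)), Set.image_id] at this
  have hstab : ∀ g ∈ G, (∀ x ∈ F, g x = x) → (g a).rep ∉ L →
      ∀ q : Projectivization K V, q.rep ∉ L → (g q).rep ∉ L := by
    intro g hg hgF hga q hq hgq
    refine hga (rep_mem_of_mem_spanClosure (F := g '' insert q F) ?_
      (apply_mem_spanClosure hg (hcl q hq)))
    rintro _ ⟨x, rfl | hx, rfl⟩
    · exact hgq
    · rw [hgF x hx]
      exact hF x hx
  obtain ⟨g, hg, hgF, hga⟩ := hk.exists_fixing haF (fun h => hp (hF p h))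
  have hgp := hstab g hg hgF (hga ▸ hp) p hp
  obtain ⟨r, hr, hrL, hrp, hrg, -⟩ := exists_mem_swap hG hp hgp
  have hfix : ∀ x ∈ F, g.symm x = x := fun x hx => by
    rw [Equiv.symm_apply_eq, hgF x hx]
  have := hstab (g⁻¹ * r * g) (G.mul_mem (G.mul_mem (G.inv_mem hg) hr) hg)
    (fun x hx => by simp [hgF x hx, hrL x (hF x hx), hfix x hx])
    (by simpa [hga, hrp] using hp) p hp
  simp only [Equiv.Perm.mul_apply, hrg] at this
  rw [← hga] at this
  simp [ha] at this

/-- A line through a point `p` of the configuration and another point of its span closure meets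
the subspace `L` in a point of the configuration, and is contained in the span closure. -/
lemma Projectivization.exists_mem_span_pair_of_mem_spanClosure [Infinite K]
    [DecidableEq (Projectivization K V)]
    (hG : ∀ T : V ≃ₗ[K] V, MulAction.toPerm T ∈ G) {L : Submodule K V}
    {F : Finset (Projectivization K V)} (hk : G.TupleTransitive (F.card + 1))
    (hcl : ∀ F' : Finset (Projectivization K V), F'.card = F.card + 1 →
      ∃ a ∈ spanClosure G (F' : Set (Projectivization K V)), a ∉ F')
    (hF : ∀ x ∈ F, x.rep ∈ L) {p a : Projectivization K V} (hp : p.rep ∉ L)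
    (ha : a ∈ spanClosure G (insert p (F : Set (Projectivization K V)))) (hap : a ≠ p)
    (haF : a ∉ F) :
    ∃ x ∈ F, a.rep ∈ Submodule.span K {p.rep, x.rep} ∧
      ∀ y : Projectivization K V, y.rep ∈ Submodule.span K {p.rep, x.rep} →
        y ∈ spanClosure G (insert p (F : Set (Projectivization K V))) := by
  have haL : a.rep ∉ L := fun h => haF (mem_of_mem_spanClosure_insert hG hk hF hp h ha)
  have hsup : a.rep ∈ Submodule.span K {p.rep} ⊔ L := by
    refine rep_mem_of_mem_spanClosure ?_ ha
    rintro x (rfl | hx)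
    · exact Submodule.mem_sup_left (Submodule.mem_span_singleton_self _)
    · exact Submodule.mem_sup_right (hF x hx)
  obtain ⟨_, hu, v, hv, hav⟩ := Submodule.mem_sup.1 hsup
  obtain ⟨α, rfl⟩ := Submodule.mem_span_singleton.1 hu
  have hα : α ≠ 0 := by
    rintro rfl
    rw [zero_smul, zero_add] at hav
    exact haL (hav ▸ hv)
  have hv0 : v ≠ 0 := by
    rintro rfl
    rw [add_zero] at hav
    exact hap (eq_of_rep_mem_span
      (hav ▸ Submodule.smul_mem _ _ (Submodule.mem_span_singleton_self _)))
  have hpv : ∀ β γ : K, β • p.rep + γ • v ∈ L → β = 0 := by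
    intro β γ h
    by_contra hβ
    rw [L.add_mem_iff_left (L.smul_mem _ hv), L.smul_mem_iff hβ] at h
    exact hp h
  set q := Projectivization.mk K v hv0 with hq
  set S := spanClosure G (insert p (F : Set (Projectivization K V))) with hS
  have hqL : q.rep ∈ L := (rep_mk_mem_iff hv0).2 hv
  have hline : ∀ y : Projectivization K V, y.rep ∈ Submodule.span K {p.rep, v} → y ≠ q → y ∈ S := by
    intro y hy hyq
    obtain ⟨β, γ, hβγ⟩ := Submodule.mem_span_pair.1 hy
    by_cases hγ : γ = 0
    · have : y = p := by
        apply eq_of_rep_mem_span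
        rw [← hβγ, hγ, zero_smul, add_zero]
        exact Submodule.smul_mem _ _ (Submodule.mem_span_singleton_self _)
      rw [this]
      exact subset_spanClosure (Set.mem_insert _ _)
    have hβ : β ≠ 0 := by
      rintro rfl
      apply hyq
      apply eq_of_rep_mem_span
      have : v ∈ Submodule.span K {q.rep} :=
        (rep_mk_mem_iff hv0).1 (Submodule.mem_span_singleton_self _)
      rw [← hβγ, zero_smul, zero_add]
      exact Submodule.smul_mem _ _ this
    obtain ⟨T, hTp, hTL⟩ := Submodule.exists_linearEquiv_scale hp
      (c := γ⁻¹ * β * α⁻¹) (mul_ne_zero (mul_ne_zero (inv_ne_zero hγ) hβ) (inv_ne_zero hα))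
    have h1 := apply_mem_spanClosure (hG T) ha
    have h2 : T • a = y := by
      apply smul_eq_of_apply_rep_mem_span
      rw [← hav, map_add, map_smul, hTp, hTL v hv, ← hβγ, Submodule.mem_span_singleton]
      refine ⟨γ⁻¹, ?_⟩
      match_scalars <;> field_simp
    have h3 : T • p = p := by
      apply smul_eq_of_apply_rep_mem_span
      rw [hTp]
      exact Submodule.smul_mem _ _ (Submodule.mem_span_singleton_self _)
    have h4 : ∀ x ∈ F, T • x = x := fun x hx => by
      apply smul_eq_of_apply_rep_mem_span
      rw [hTL _ (hF x hx)]
      exact Submodule.mem_span_singleton_self _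
    rw [MulAction.toPerm_apply, h2, Set.image_insert_eq, MulAction.toPerm_apply, h3,
      Set.image_congr (f := MulAction.toPerm T) (g := id) (fun x hx => h4 x hx), Set.image_id] at h1
    exact h1
  have hqF : q ∈ F := by
    apply mem_of_mem_spanClosure_insert hG hk hF hp hqL
    have hpS : p.rep ∉ Submodule.span K {v} := fun h =>
      hp (Submodule.span_le.2 (Set.singleton_subset_iff.2 hv) h)
    have hinf := (infinite_setOf_rep_mem_span_pair hv0 hpS).sdiff (Set.finite_singleton q)
    obtain ⟨F', hF', hcard⟩ := hinf.exists_subset_card_eq (F.card + 1)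
    have hF'U : ∀ x ∈ F', x.rep ∈ Submodule.span K {p.rep, v} := fun x hx => (hF' hx).1
    obtain ⟨b, hb, hbF⟩ := hcl F' hcard
    have hbU := rep_mem_of_mem_spanClosure hF'U hb
    have hqU : q.rep ∈ Submodule.span K {p.rep, v} :=
      (rep_mk_mem_iff hv0).2 (Submodule.subset_span (by simp))
    obtain ⟨r, hr, -, hrb, -, hrU⟩ := exists_mem_swap (L := ⊥) hG
      (p := b) (q := q) (by simpa using b.rep_nonzero) (by simpa using q.rep_nonzero)
    have h1 := apply_mem_spanClosure hr hb
    rw [hrb] at h1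
    refine spanClosure_subset ?_ h1
    rintro _ ⟨x, hx, rfl⟩
    refine hline _ (hrU _ hbU hqU x (hF' hx).1) fun h => hbF ?_
    rw [← hrb] at h
    rwa [r.injective h] at hx
  have hspan : Submodule.span K {p.rep, q.rep} = Submodule.span K {p.rep, v} := by
    rw [Submodule.span_insert, Submodule.span_insert, ← submodule_eq p, ← submodule_eq q, hq,
      submodule_mk]
  refine ⟨q, hqF, ?_, fun y hy => ?_⟩
  · rw [hspan, ← hav]
    exact Submodule.mem_span_pair.2 ⟨α, 1, by simp⟩
  · by_cases hyq : y = q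
    · rw [hyq]
      exact subset_spanClosure (Set.mem_insert_of_mem _ hqF)
    · exact hline y (hspan ▸ hy) hyq

lemma Projectivization.exists_line_notMem (hV : 3 ≤ Module.finrank K V) :
    ∃ (p : Projectivization K V) (u v : V), v ≠ 0 ∧ u ∉ Submodule.span K {v} ∧
      p.rep ∉ Submodule.span K {u, v} := by
  obtain ⟨e, he⟩ := exists_linearIndependent_of_le_finrank hV
  have h0 := he.notMem_span_image (s := {1, 2}) (x := 0) (by decide)
  have h1 := he.notMem_span_image (s := {2}) (x := 1) (by decide)
  refine ⟨Projectivization.mk K (e 0) (he.ne_zero 0), e 1, e 2, he.ne_zero 2, ?_, ?_⟩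
  · simpa using h1
  · rw [rep_mk_mem_iff]
    simpa [Set.image_insert_eq] using h0

/-- If a configuration is not closed under the span closure, no configuration of the same size
is. -/
lemma Projectivization.exists_mem_spanClosure_notMem {F : Finset (Projectivization K V)}
    (hk : G.TupleTransitive F.card) {a : Projectivization K V}
    (ha : a ∈ spanClosure G (F : Set (Projectivization K V))) (haF : a ∉ F)
    (F' : Finset (Projectivization K V)) (hF' : F'.card = F.card) :
    ∃ b ∈ spanClosure G (F' : Set (Projectivization K V)), b ∉ F' := by
  classical
  obtain ⟨g, hg, rfl⟩ := hk.exists_image_eq hF'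
  exact ⟨g a, by simpa using apply_mem_spanClosure hg ha, by simpa using haF⟩

lemma Projectivization.spanClosure_subset_of_three_le_card [Infinite K]
    (hV : 3 ≤ Module.finrank K V) (hG : ∀ T : V ≃ₗ[K] V, MulAction.toPerm T ∈ G)
    {F : Finset (Projectivization K V)} (hF : 3 ≤ F.card) (hk : G.TupleTransitive F.card) :
    spanClosure G (F : Set (Projectivization K V)) ⊆ F := by
  classical
  by_contra hcon
  obtain ⟨a₀, ha₀, ha₀F⟩ := Set.not_subset.1 hcon
  obtain ⟨k, hFk⟩ : ∃ k, F.card = k + 1 := ⟨F.card - 1, by omega⟩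
  have hcl := exists_mem_spanClosure_notMem hk ha₀ (by simpa using ha₀F)
  rw [hFk] at hcl hk hF
  obtain ⟨p, u, v, hv, hu, hp⟩ := exists_line_notMem hV
  set L := Submodule.span K {u, v} with hL
  obtain ⟨F₁, hF₁, hcard₁⟩ := (infinite_setOf_rep_mem_span_pair hv hu).exists_subset_card_eq k
  replace hF₁ : ∀ x ∈ F₁, x.rep ∈ L := fun x hx => hF₁ hx
  have hpF₁ : p ∉ F₁ := fun h => hp (hF₁ p h)
  obtain ⟨a, ha, haF⟩ := hcl (insert p F₁) (by rw [Finset.card_insert_of_notMem hpF₁, hcard₁])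
  rw [Finset.mem_insert, not_or] at haF
  rw [Finset.coe_insert] at ha
  obtain ⟨x, hx, -, hpx⟩ := exists_mem_span_pair_of_mem_spanClosure hG (hcard₁ ▸ hk)
    (hcard₁ ▸ hcl) hF₁ hp ha haF.1 haF.2
  obtain ⟨y, hy, hyx⟩ := F₁.exists_mem_ne (by omega) x
  have hpx_ne : p.rep ∉ Submodule.span K {x.rep} := fun h =>
    hp (Submodule.span_le.2 (Set.singleton_subset_iff.2 (hF₁ x hx)) h)
  have hyM : y.rep ∉ Submodule.span K {p.rep, x.rep} := by
    intro h
    have hxM : x.rep ∈ Submodule.span K {p.rep, x.rep} := Submodule.subset_span (by simp)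
    have h1 := span_pair_eq_of_ne hyx h hxM
    refine hp ?_
    have h2 : p.rep ∈ Submodule.span K {y.rep, x.rep} := h1 ▸ Submodule.subset_span (by simp)
    exact Submodule.span_le.2 (Set.pair_subset (hF₁ y hy) (hF₁ x hx)) h2
  obtain ⟨F₂, hF₂, hcard₂⟩ := ((infinite_setOf_rep_mem_span_pair x.rep_nonzero hpx_ne).sdiff
    (Set.finite_singleton p)).exists_subset_card_eq k
  have hyF₂ : y ∉ F₂ := fun h => hyM (hF₂ h).1
  obtain ⟨b, hb, hbF⟩ := hcl (insert y F₂) (by rw [Finset.card_insert_of_notMem hyF₂, hcard₂])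
  rw [Finset.mem_insert, not_or] at hbF
  rw [Finset.coe_insert] at hb
  obtain ⟨z, hz, -, hyz⟩ := exists_mem_span_pair_of_mem_spanClosure hG (hcard₂ ▸ hk)
    (hcard₂ ▸ hcl) (fun w hw => (hF₂ hw).1) hyM hb hbF.1 hbF.2
  have hsub : spanClosure G (insert y (F₂ : Set (Projectivization K V))) ⊆
      spanClosure G (insert p (F₁ : Set (Projectivization K V))) := by
    refine spanClosure_subset (Set.insert_subset ?_ fun w hw => hpx w (hF₂ hw).1)
    exact subset_spanClosure (Set.mem_insert_of_mem _ hy)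
  have hyz_ne : y.rep ∉ Submodule.span K {z.rep} := fun h =>
    hyM (Submodule.span_le.2 (Set.singleton_subset_iff.2 (hF₂ hz).1) h)
  have hmem : ∀ c ∈ {c : Projectivization K V | c.rep ∈ Submodule.span K {y.rep, z.rep}} \
      (insert p F₁ : Finset _), ∃ w ∈ F₁, c.rep ∈ Submodule.span K {p.rep, w.rep} := by
    intro c hc
    have hcF : c ≠ p ∧ c ∉ F₁ := by simpa using hc.2
    obtain ⟨w, hw, hcw, -⟩ := exists_mem_span_pair_of_mem_spanClosure hG (hcard₁ ▸ hk)
      (hcard₁ ▸ hcl) hF₁ hp (hsub (hyz c hc.1)) hcF.1 hcF.2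
    exact ⟨w, hw, hcw⟩
  have : Nonempty (Projectivization K V) := ⟨p⟩
  choose! w hwF hw using hmem
  obtain ⟨c, hc, d, hd, hcd, hcdw⟩ :=
    ((infinite_setOf_rep_mem_span_pair z.rep_nonzero hyz_ne).sdiff
      (insert p F₁).finite_toSet).exists_ne_map_eq_of_mapsTo hwF F₁.finite_toSet
  have h1 := span_pair_eq_of_ne hcd (hw c hc) (hcdw ▸ hw d hd)
  rw [span_pair_eq_of_ne hcd hc.1 hd.1] at h1
  have hp1 : p.rep ∈ Submodule.span K {y.rep, z.rep} := h1 ▸ Submodule.subset_span (by simp)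
  have hz1 : z.rep ∈ Submodule.span K {y.rep, z.rep} := Submodule.subset_span (by simp)
  have hpz : p ≠ z := fun h => (hF₂ hz).2 h.symm
  have h2 := span_pair_eq_of_ne hpz hp1 hz1
  have hpM : p.rep ∈ Submodule.span K {p.rep, x.rep} := Submodule.subset_span (by simp)
  exact hyM (Submodule.span_le.2 (Set.pair_subset hpM (hF₂ hz).1)
    (h2 ▸ Submodule.subset_span (by simp) : y.rep ∈ Submodule.span K {p.rep, z.rep}))

lemma Projectivization.rep_apply_mem_span_pair
    (hG : ∀ T : V ≃ₗ[K] V, MulAction.toPerm T ∈ G)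
    (hcl : ∀ x y : Projectivization K V, x ≠ y → ∃ a ∈ spanClosure G {x, y}, a ≠ x ∧ a ≠ y)
    {g : Equiv.Perm (Projectivization K V)} (hg : g ∈ G) {x y z : Projectivization K V}
    (hz : z.rep ∈ Submodule.span K {x.rep, y.rep}) :
    (g z).rep ∈ Submodule.span K {(g x).rep, (g y).rep} := by
  obtain ⟨γ, δ, hzγ⟩ := Submodule.mem_span_pair.1 hz
  by_cases hγ : γ = 0
  · have : z = y := eq_of_rep_mem_span (Submodule.mem_span_singleton.2 ⟨δ, by simp [← hzγ, hγ]⟩)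
    rw [this]
    exact Submodule.subset_span (by simp)
  by_cases hδ : δ = 0
  · have : z = x := eq_of_rep_mem_span (Submodule.mem_span_singleton.2 ⟨γ, by simp [← hzγ, hδ]⟩)
    rw [this]
    exact Submodule.subset_span (by simp)
  by_cases hxy : x = y
  · have : z = x := eq_of_rep_mem_span (by simpa [hxy] using hz)
    rw [this]
    exact Submodule.subset_span (by simp)
  obtain ⟨a, ha, hax, hay⟩ := hcl x y hxy
  obtain ⟨α, β, haα⟩ := Submodule.mem_span_pair.1
    (rep_mem_of_mem_spanClosure (U := Submodule.span K {x.rep, y.rep})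
      (by rintro _ (rfl | rfl) <;> exact Submodule.subset_span (by simp)) ha)
  have hα : α ≠ 0 := by
    rintro rfl
    exact hay (eq_of_rep_mem_span (Submodule.mem_span_singleton.2 ⟨β, by simp [← haα]⟩))
  have hβ : β ≠ 0 := by
    rintro rfl
    exact hax (eq_of_rep_mem_span (Submodule.mem_span_singleton.2 ⟨α, by simp [← haα]⟩))
  obtain ⟨T, hTx, hTy⟩ := Submodule.exists_linearEquiv_scale
    (fun h => hxy (eq_of_rep_mem_span h))
    (div_ne_zero (mul_ne_zero hγ hβ) (mul_ne_zero hα hδ))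
  have hy : y.rep ∈ Submodule.span K {y.rep} := Submodule.mem_span_singleton_self _
  have hTa : T • a = z := by
    apply smul_eq_of_apply_rep_mem_span
    rw [← haα, map_add, map_smul, map_smul, hTx, hTy _ hy, ← hzγ, Submodule.mem_span_singleton]
    refine ⟨β / δ, ?_⟩
    match_scalars <;> field_simp
  have hTx' : T • x = x := smul_eq_of_apply_rep_mem_span
    (hTx ▸ Submodule.smul_mem _ _ (Submodule.mem_span_singleton_self _))
  have hTy' : T • y = y := smul_eq_of_apply_rep_mem_span ((hTy _ hy).symm ▸ hy)
  have h := apply_mem_spanClosure (hG T) ha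
  rw [Set.image_pair, MulAction.toPerm_apply, MulAction.toPerm_apply, MulAction.toPerm_apply, hTa,
    hTx', hTy'] at h
  simpa [Set.image_pair] using h g hg

lemma Projectivization.exists_notMem_ne {N : Submodule K V} {p q : Projectivization K V}
    (hp : p.rep ∉ N) (hpq : q ≠ p) : ∃ c : Projectivization K V, c.rep ∉ N ∧ c ≠ p := by
  by_cases hq : q.rep ∈ N
  · have h0 : p.rep + q.rep ∉ N := fun h => hp ((N.add_mem_iff_left hq).1 h)
    have h1 : p.rep + q.rep ≠ 0 := fun h => h0 (h ▸ N.zero_mem)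
    refine ⟨Projectivization.mk K _ h1, (rep_mk_mem_iff h1).not.2 h0, fun h => hpq ?_⟩
    apply eq_of_rep_mem_span
    have h2 : p.rep + q.rep ∈ Submodule.span K {p.rep} :=
      by
      rw [← rep_mk_mem_iff h1, h]
      exact Submodule.mem_span_singleton_self _
    exact (Submodule.add_mem_iff_right _ (Submodule.mem_span_singleton_self _)).1 h2
  · exact ⟨q, hq, hpq⟩

/-- A point of a line `L` outside a closed configuration on `L` can be moved off `L` while fixing
the configuration. -/
lemma Projectivization.exists_fixing_apply_notMem
    (hG : ∀ T : V ≃ₗ[K] V, MulAction.toPerm T ∈ G) {u v : V} {p : Projectivization K V}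
    (hp : p.rep ∉ Submodule.span K {u, v}) {F : Set (Projectivization K V)}
    (hF : ∀ x ∈ F, x.rep ∈ Submodule.span K {u, v}) {a : Projectivization K V}
    (ha : a ∉ spanClosure G F) (haF : a ∉ F) :
    ∃ h ∈ G, (∀ x ∈ F, h x = x) ∧ (h a).rep ∉ Submodule.span K {u, v} := by
  set L := Submodule.span K {u, v} with hL
  by_cases haL : a.rep ∈ L
  swap
  · exact ⟨1, G.one_mem, by simp, by simpa using haL⟩
  simp only [spanClosure, Set.mem_ofPred_eq, not_forall] at ha
  obtain ⟨g, hg, hga⟩ := ha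
  set N := Submodule.span K ((fun x => (g x).rep) '' F) with hN
  have hFN : ∀ x ∈ F, (g x).rep ∈ N := fun x hx => Submodule.subset_span ⟨x, hx, rfl⟩
  by_cases hc : ∃ c : Projectivization K V, c.rep ∉ N ∧ (g.symm c).rep ∉ L
  · obtain ⟨c, hcN, hcL⟩ := hc
    obtain ⟨r, hr, hrN, hra, -, -⟩ := exists_mem_swap hG hga hcN
    refine ⟨g⁻¹ * r * g, G.mul_mem (G.mul_mem (G.inv_mem hg) hr) hg, fun x hx => ?_, ?_⟩
    · simp [hrN _ (hFN x hx)]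
    · simpa [hra] using hcL
  push Not at hc
  have hpa : p ≠ a := fun h => hp (h ▸ haL)
  obtain ⟨c, hcN, hca⟩ := exists_notMem_ne (q := g p) hga (fun h => hpa (g.injective h))
  obtain ⟨r, hr, hrN, hra, -, -⟩ := exists_mem_swap hG hga hcN
  have hfix : ∀ x : Projectivization K V, x.rep ∉ L → g.symm (r (g x)) = x := by
    intro x hx
    have hgx : (g x).rep ∈ N := by
      by_contra h
      exact hx (by simpa using hc _ h)
    rw [hrN _ hgx, Equiv.symm_apply_apply]
  set b := g.symm c with hb
  have hbL : b.rep ∈ L := hc c hcN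
  have hba : b ≠ a := fun h => hca (by rw [← h, hb, Equiv.apply_symm_apply])
  have hspan : Submodule.span K {b.rep, a.rep} = L := span_pair_eq_of_ne hba hbL haL
  obtain ⟨T, hTa, hTb, -, -⟩ := exists_smul_swap (L := Submodule.span K {a.rep}) (p := b) (q := p)
    (fun h => hba (eq_of_rep_mem_span h)) (fun h => hpa (eq_of_rep_mem_span h))
  replace hTa : T • a = a := hTa a (Submodule.mem_span_singleton_self _)
  have hTL : ∀ y : Projectivization K V, y.rep ∈ L → (T • y).rep ∈ L → T • y = a := by
    intro y hy hTy
    have h1 : (T • y).rep ∈ Submodule.span K {p.rep, a.rep} := by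
      rw [← hspan] at hy
      obtain ⟨β, α, hy⟩ := Submodule.mem_span_pair.1 hy
      rw [rep_smul_mem_iff, ← hy, map_add, map_smul, map_smul]
      refine Submodule.add_mem _ (Submodule.smul_mem _ _ ?_) (Submodule.smul_mem _ _ ?_)
      · rw [← rep_smul_mem_iff, hTb]
        exact Submodule.subset_span (by simp)
      · rw [← rep_smul_mem_iff, hTa]
        exact Submodule.subset_span (by simp)
    by_contra hne
    have h2 := span_pair_eq_of_ne hne h1 (Submodule.subset_span (by simp))
    exact hp (Submodule.span_le.2 (Set.pair_subset hTy haL)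
      (h2 ▸ Submodule.subset_span (by simp) : p.rep ∈ Submodule.span K {(T • y).rep, a.rep}))
  refine ⟨MulAction.toPerm T * (g⁻¹ * r * g) * (MulAction.toPerm T)⁻¹,
    G.mul_mem (G.mul_mem (hG T) (G.mul_mem (G.mul_mem (G.inv_mem hg) hr) hg))
      (G.inv_mem (hG T)), fun x hx => ?_, ?_⟩
  · have : (T⁻¹ • x).rep ∉ L := fun h => haF (by
      have := hTL _ h (by simpa using hF x hx)
      rw [smul_inv_smul] at this
      exact this ▸ hx)
    simp [hfix _ this]
  · have : T⁻¹ • a = a := by rw [inv_smul_eq_iff, hTa]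
    simp only [Equiv.Perm.mul_apply, Equiv.Perm.inv_def, MulAction.toPerm_symm_apply,
      MulAction.toPerm_apply, this, hra, ← hb, hTb]
    exact hp

lemma Projectivization.tupleTransitive_succ [Infinite K]
    (hV : 3 ≤ Module.finrank K V) (hG : ∀ T : V ≃ₗ[K] V, MulAction.toPerm T ∈ G) {k : ℕ}
    (hk : G.TupleTransitive k)
    (hcl : ∀ F : Finset (Projectivization K V), F.card = k →
      spanClosure G (F : Set (Projectivization K V)) ⊆ F) :
    G.TupleTransitive (k + 1) := by
  classical
  obtain ⟨p, u, v, hv, hu, hp⟩ := exists_line_notMem hV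
  have hinf := infinite_setOf_rep_mem_span_pair hv hu
  let f₀ : Fin k → Projectivization K V := fun i => hinf.natEmbedding _ i
  have hf₀ : Function.Injective f₀ :=
    Subtype.val_injective.comp ((hinf.natEmbedding _).injective.comp Fin.val_injective)
  have hf₀L : ∀ i, (f₀ i).rep ∈ Submodule.span K {u, v} := fun i =>
    (hinf.natEmbedding _ i).2
  have key : ∀ f : Fin (k + 1) → Projectivization K V, Function.Injective f →
      ∃ σ ∈ G, (∀ i : Fin k, σ (f i.castSucc) = f₀ i) ∧ σ (f (Fin.last k)) = p := by
    intro f hf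
    obtain ⟨σ, hσ, hσf⟩ := hk (fun i => f i.castSucc) f₀
      (hf.comp (Fin.castSucc_injective k)) hf₀
    have ha : σ (f (Fin.last k)) ∉ Finset.univ.image f₀ := by
      simp only [Finset.mem_image, Finset.mem_univ, true_and, not_exists]
      intro i hi
      rw [← hσf i] at hi
      exact (Fin.castSucc_lt_last i).ne (hf (σ.injective hi))
    have hcard : (Finset.univ.image f₀).card = k := by
      rw [Finset.card_image_of_injective _ hf₀, Finset.card_fin]
    obtain ⟨h, hh, hhf, hha⟩ := exists_fixing_apply_notMem hG hp
      (F := (Finset.univ.image f₀ : Finset _)) (by simpa using hf₀L)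
      (fun h => ha (hcl _ hcard h)) ha
    obtain ⟨r, hr, hrL, hrp, -, -⟩ := exists_mem_swap hG hha hp
    refine ⟨r * h * σ, G.mul_mem (G.mul_mem hr hh) hσ, fun i => ?_, by simpa using hrp⟩
    simp only [Equiv.Perm.mul_apply]
    rw [hσf, hhf _ (by simp), hrL _ (hf₀L i)]
  intro f g hf hg
  obtain ⟨σ, hσ, hσf, hσp⟩ := key f hf
  obtain ⟨τ, hτ, hτg, hτp⟩ := key g hg
  refine ⟨τ⁻¹ * σ, G.mul_mem (G.inv_mem hτ) hσ, fun i => ?_⟩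
  rw [Equiv.Perm.mul_apply, Equiv.Perm.inv_eq_iff_eq]
  refine Fin.lastCases ?_ (fun j => ?_) i
  · rw [hσp, hτp]
  · rw [hσf, hτg]

/-- A group of permutations of a projective space of dimension at least two which contains all
projective transformations and does not preserve collinearity is highly transitive. -/
theorem Projectivization.tupleTransitive_of_not_collinear [Infinite K]
    (hV : 3 ≤ Module.finrank K V) (hG : ∀ T : V ≃ₗ[K] V, MulAction.toPerm T ∈ G)
    (hcol : ¬ ∀ g ∈ G, ∀ x y z : Projectivization K V,
      z.rep ∈ Submodule.span K {x.rep, y.rep} →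
        (g z).rep ∈ Submodule.span K {(g x).rep, (g y).rep}) (k : ℕ) :
    G.TupleTransitive k := by
  classical
  induction k with
  | zero => exact fun f g _ _ => ⟨1, G.one_mem, fun i => i.elim0⟩
  | succ k ih =>
    refine tupleTransitive_succ hV hG ih fun F hF a ha => ?_
    rcases lt_or_ge 2 k with h | h
    · exact spanClosure_subset_of_three_le_card hV hG (hF ▸ h) (hF ▸ ih) ha
    interval_cases k
    · rw [Finset.card_eq_zero] at hF
      subst hF
      have := rep_mem_of_mem_spanClosure (U := ⊥) (by simp) ha
      exact (a.rep_nonzero (by simpa using this)).elim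
    · obtain ⟨x, rfl⟩ := Finset.card_eq_one.1 hF
      have := rep_mem_of_mem_spanClosure (U := Submodule.span K {x.rep})
        (by simp) ha
      simpa using eq_of_rep_mem_span this
    · by_contra haF
      refine hcol fun g hg x y z hz => rep_apply_mem_span_pair hG (fun x y hxy => ?_) hg hz
      obtain ⟨b, hb, hbF⟩ := exists_mem_spanClosure_notMem (hF ▸ ih) ha haF {x, y}
        (by rw [hF, Finset.card_pair hxy])
      exact ⟨b, by simpa using hb, by simpa using hbF⟩

end Transitivity

section Collineation

variable {φ : Equiv.Perm (Projectivization K V)}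

/-- A collineation fixing a spanning set of a subspace preserves the subspace. -/
lemma Projectivization.apply_rep_mem_span
    (hφ : ∀ x y z : Projectivization K V, z.rep ∈ Submodule.span K {x.rep, y.rep} →
      (φ z).rep ∈ Submodule.span K {(φ x).rep, (φ y).rep})
    {S : Set V} {U : Submodule K V}
    (hS : ∀ s ∈ S, ∀ hs : s ≠ 0, (φ (Projectivization.mk K s hs)).rep ∈ U)
    {x : V} (hx : x ∈ Submodule.span K S) (hx0 : x ≠ 0) :
    (φ (Projectivization.mk K x hx0)).rep ∈ U := by
  induction hx using Submodule.span_induction with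
  | mem s hs => exact hS s hs hx0
  | zero => exact (hx0 rfl).elim
  | add y z _ _ hy hz =>
    by_cases hy0 : y = 0
    · subst hy0
      simpa using hz (by simpa using hx0)
    by_cases hz0 : z = 0
    · subst hz0
      simpa using hy (by simpa using hx0)
    refine Submodule.span_le.2 (Set.pair_subset (hy hy0) (hz hz0)) (hφ _ _ _ ?_)
    rw [rep_mk_mem_iff]
    refine Submodule.add_mem _ ((rep_mk_mem_iff hy0).1 (Submodule.subset_span (by simp)))
      ((rep_mk_mem_iff hz0).1 (Submodule.subset_span (by simp)))
  | smul c y _ hy =>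
    have hc : c ≠ 0 := fun h => hx0 (by simp [h])
    have hy0 : y ≠ 0 := fun h => hx0 (by simp [h])
    have : Projectivization.mk K (c • y) hx0 = Projectivization.mk K y hy0 :=
      (Projectivization.mk_eq_mk_iff' K _ _ _ _).2 ⟨c, rfl⟩
    rw [this]
    exact hy hy0

/-- `φ` fixes the line spanned by `v`, a vacuous condition if `v = 0`. -/
def Projectivization.FixesLine (φ : Equiv.Perm (Projectivization K V)) (v : V) : Prop :=
  ∀ hv : v ≠ 0, φ (Projectivization.mk K v hv) = Projectivization.mk K v hv

lemma Projectivization.FixesLine.of_mem_span {v w : V} (h : FixesLine φ v)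
    (hw : w ∈ Submodule.span K {v}) : FixesLine φ w := by
  intro hw0
  obtain ⟨c, rfl⟩ := Submodule.mem_span_singleton.1 hw
  have hv : v ≠ 0 := fun h => hw0 (by simp [h])
  have : Projectivization.mk K (c • v) hw0 = Projectivization.mk K v hv :=
    (Projectivization.mk_eq_mk_iff' K _ _ _ _).2 ⟨c, rfl⟩
  rw [this, h hv]

/-- The intersection point of two subspaces spanned by fixed points is fixed. -/
lemma Projectivization.FixesLine.of_inf_le
    (hφ : ∀ x y z : Projectivization K V, z.rep ∈ Submodule.span K {x.rep, y.rep} →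
      (φ z).rep ∈ Submodule.span K {(φ x).rep, (φ y).rep})
    {S S' : Set V} (hS : ∀ s ∈ S, FixesLine φ s) (hS' : ∀ s ∈ S', FixesLine φ s) {x : V}
    (hx : x ∈ Submodule.span K S) (hx' : x ∈ Submodule.span K S')
    (h : ∀ y ∈ Submodule.span K S, y ∈ Submodule.span K S' → y ∈ Submodule.span K {x}) :
    FixesLine φ x := by
  intro hx0
  have key : ∀ S : Set V, (∀ s ∈ S, FixesLine φ s) → x ∈ Submodule.span K S →
      (φ (Projectivization.mk K x hx0)).rep ∈ Submodule.span K S := by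
    intro S hS hx
    refine apply_rep_mem_span hφ (fun s hs hs0 => ?_) hx hx0
    rw [hS s hs hs0, rep_mk_mem_iff]
    exact Submodule.subset_span hs
  apply eq_of_rep_mem_span
  have h1 := h _ (key S hS hx) (key S' hS' hx')
  refine Submodule.span_le.2 (Set.singleton_subset_iff.2 ?_) h1
  exact (rep_mk_mem_iff hx0).1 (Submodule.mem_span_singleton_self _)

end Collineation

end Projective

section Rational

variable {V : Type*} [AddCommGroup V] [Module ℚ V] {φ : Equiv.Perm (Projectivization ℚ V)}

/-- A collineation of a rational projective space fixing a frame is trivial. -/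
lemma Projectivization.eq_one_of_fixesLine
    (hφ : ∀ x y z : Projectivization ℚ V, z.rep ∈ Submodule.span ℚ {x.rep, y.rep} →
      (φ z).rep ∈ Submodule.span ℚ {(φ x).rep, (φ y).rep})
    {S : Set V} {e : V} (he : e ∉ Submodule.span ℚ S)
    (htop : ∀ x : V, ∃ c : ℚ, ∃ w ∈ Submodule.span ℚ S, x = c • e + w)
    (hS : ∀ v : V, ∃ s ∈ S, s ∉ Submodule.span ℚ {v})
    (hfe : FixesLine φ e) (hfS : ∀ s ∈ S, FixesLine φ s)
    (hfeS : ∀ s ∈ S, FixesLine φ (e + s)) : φ = 1 := by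
  set W := Submodule.span ℚ S with hW
  have indep : ∀ v ∈ W, ∀ w ∈ W, v ≠ 0 → w ∉ Submodule.span ℚ {v} →
      ∀ a b c : ℚ, a • e + b • v + c • w = 0 → a = 0 ∧ b = 0 ∧ c = 0 := by
    intro v hv w hw hv0 hwv a b c h
    have ha : a = 0 := by
      by_contra ha
      refine he ((W.smul_mem_iff ha).1 ?_)
      rw [add_assoc] at h
      rw [eq_neg_of_add_eq_zero_left h]
      exact W.neg_mem (W.add_mem (W.smul_mem _ hv) (W.smul_mem _ hw))
    have hc : c = 0 := by
      by_contra hc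
      refine hwv (((Submodule.span ℚ {v}).smul_mem_iff hc).1 ?_)
      rw [ha, zero_smul, zero_add] at h
      rw [eq_neg_of_add_eq_zero_right h]
      exact Submodule.neg_mem _ (Submodule.smul_mem _ _ (Submodule.mem_span_singleton_self _))
    refine ⟨ha, ?_, hc⟩
    simpa [ha, hc, hv0] using h
  have hsub : ∀ v w : V, v ∈ W → w ∈ W → FixesLine φ (e + v) → FixesLine φ (e + w) →
      FixesLine φ (v - w) := by
    intro v w hv hw hfv hfw
    refine FixesLine.of_inf_le hφ (S := {e + v, e + w}) (S' := S) ?_ hfS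
      (Submodule.mem_span_pair.2 ⟨1, -1, by module⟩) (W.sub_mem hv hw) ?_
    · rintro _ (rfl | rfl) <;> assumption
    · intro y hy hyW
      obtain ⟨a, b, rfl⟩ := Submodule.mem_span_pair.1 hy
      have hab : a + b = 0 := by
        by_contra hab
        refine he ((W.smul_mem_iff hab).1 ?_)
        have : (a + b) • e = (a • (e + v) + b • (e + w)) - (a • v + b • w) := by module
        rw [this]
        exact W.sub_mem hyW (W.add_mem (W.smul_mem _ hv) (W.smul_mem _ hw))
      rw [Submodule.mem_span_singleton]
      refine ⟨a, ?_⟩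
      rw [eq_neg_of_add_eq_zero_right hab]
      module
  have hdir : ∀ v ∈ W, FixesLine φ (e + v) → FixesLine φ v := fun v hv hfv => by
    simpa using hsub v 0 hv W.zero_mem hfv (by simpa using hfe)
  have hmeet : ∀ v ∈ W, ∀ w ∈ W, v ≠ 0 → w ∉ Submodule.span ℚ {v} →
      ∀ a b c d x : V, FixesLine φ a → FixesLine φ b → FixesLine φ c → FixesLine φ d →
      x ∈ Submodule.span ℚ {a, b} → x ∈ Submodule.span ℚ {c, d} →
      (∀ α β γ δ : ℚ, α • a + β • b = γ • c + δ • d → ∃ t : ℚ, t • x = α • a + β • b) →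
      FixesLine φ x := by
    intro v hv w hw hv0 hwv a b c d x ha hb hc hd hx hx' h
    refine FixesLine.of_inf_le hφ (S := {a, b}) (S' := {c, d}) ?_ ?_ hx hx' ?_
    · rintro _ (rfl | rfl) <;> assumption
    · rintro _ (rfl | rfl) <;> assumption
    · intro y hy hy'
      obtain ⟨α, β, rfl⟩ := Submodule.mem_span_pair.1 hy
      obtain ⟨γ, δ, h'⟩ := Submodule.mem_span_pair.1 hy'
      exact Submodule.mem_span_singleton.2 (h α β γ δ h'.symm)
  have hadd : ∀ v ∈ W, ∀ w ∈ W, v ≠ 0 → w ∉ Submodule.span ℚ {v} →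
      FixesLine φ (e + v) → FixesLine φ (e + w) → FixesLine φ (e + (v + w)) := by
    intro v hv w hw hv0 hwv hfv hfw
    refine hmeet v hv w hw hv0 hwv (e + v) w (e + w) v _ hfv (hdir w hw hfw) hfw (hdir v hv hfv)
      (Submodule.mem_span_pair.2 ⟨1, 1, by module⟩) (Submodule.mem_span_pair.2 ⟨1, 1, by module⟩) ?_
    intro α β γ δ h
    obtain ⟨h1, h2, h3⟩ := indep v hv w hw hv0 hwv (α - γ) (α - δ) (β - γ) (by
      rw [← sub_eq_zero] at h
      rw [← h]; module)
    refine ⟨α, ?_⟩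
    rw [show β = α by linarith]
    module
  have hsub' : ∀ v ∈ W, ∀ w ∈ W, v ≠ 0 → w ∉ Submodule.span ℚ {v} →
      FixesLine φ (e + v) → FixesLine φ (e + w) → FixesLine φ (e + (v - w)) := by
    intro v hv w hw hv0 hwv hfv hfw
    refine hmeet v hv w hw hv0 hwv (e + v) w e (v - w) _ hfv (hdir w hw hfw) hfe
      (hsub v w hv hw hfv hfw)
      (Submodule.mem_span_pair.2 ⟨1, -1, by module⟩)
      (Submodule.mem_span_pair.2 ⟨1, 1, by module⟩) ?_
    intro α β γ δ h
    obtain ⟨h1, h2, h3⟩ := indep v hv w hw hv0 hwv (α - γ) (α - δ) (β + δ) (by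
      rw [← sub_eq_zero] at h
      rw [← h]; module)
    refine ⟨α, ?_⟩
    rw [show β = -α by linarith]
    module
  have hdiv : ∀ v ∈ W, ∀ w ∈ W, v ≠ 0 → w ∉ Submodule.span ℚ {v} → ∀ m : ℚ, m ≠ 0 →
      FixesLine φ (e + v) → FixesLine φ (e + w) → FixesLine φ (e + m • w) →
      FixesLine φ (e + m⁻¹ • v) := by
    intro v hv w hw hv0 hwv m hm hfv hfw hfmw
    refine hmeet v hv w hw hv0 hwv (e + w) (v - m • w) e v _ hfw
      (hsub v _ hv (W.smul_mem _ hw) hfv hfmw) hfe (hdir v hv hfv)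
      (Submodule.mem_span_pair.2 ⟨1, m⁻¹, ?_⟩) (Submodule.mem_span_pair.2 ⟨1, m⁻¹, by module⟩) ?_
    · match_scalars <;> field_simp
      ring
    intro α β γ δ h
    obtain ⟨h1, h2, h3⟩ := indep v hv w hw hv0 hwv (α - γ) (β - δ) (α - β * m) (by
      rw [← sub_eq_zero] at h
      rw [← h]; module)
    refine ⟨α, ?_⟩
    rw [show α = β * m by linarith]
    match_scalars <;> field_simp
    ring
  have notMem_symm : ∀ v w : V, v ≠ 0 → w ∉ Submodule.span ℚ {v} →
      w ≠ 0 ∧ v ∉ Submodule.span ℚ {w} := by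
    intro v w hv hw
    refine ⟨fun h => hw (h ▸ Submodule.zero_mem _), fun h => hw ?_⟩
    obtain ⟨c, rfl⟩ := Submodule.mem_span_singleton.1 h
    have hc : c ≠ 0 := fun hc => hv (by simp [hc])
    exact Submodule.mem_span_singleton.2 ⟨c⁻¹, by simp [smul_smul, hc]⟩
  have hadd' : ∀ v ∈ W, ∀ w ∈ W, FixesLine φ (e + v) → FixesLine φ (e + w) →
      FixesLine φ (e + (v + w)) := by
    intro v hv w hw hfv hfw
    by_cases hv0 : v = 0
    · simpa [hv0] using hfw
    by_cases hw0 : w = 0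
    · simpa [hw0] using hfv
    by_cases hwv : w ∈ Submodule.span ℚ {v}
    swap
    · exact hadd v hv w hw hv0 hwv hfv hfw
    by_cases hvw : v + w = 0
    · simpa [hvw] using hfe
    obtain ⟨s, hs, hsv⟩ := hS v
    have hsW : s ∈ W := Submodule.subset_span hs
    have hv1 : v ∈ Submodule.span ℚ {v} := Submodule.mem_span_singleton_self _
    obtain ⟨c, hc⟩ := Submodule.mem_span_singleton.1 hwv
    have hc0 : c ≠ 0 := fun h => hw0 (by simp [← hc, h])
    have hvs : v + s ∉ Submodule.span ℚ {w} := fun h => hsv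
      ((Submodule.add_mem_iff_right _ hv1).1
        (Submodule.span_le.2 (Set.singleton_subset_iff.2 hwv) h))
    have h1 := hadd w hw (v + s) (W.add_mem hv hsW) hw0 hvs hfw
      (hadd v hv s hsW hv0 hsv hfv (hfeS s hs))
    have hsvw : s ∉ Submodule.span ℚ {v + w} := fun h => hsv
      (Submodule.span_le.2 (Set.singleton_subset_iff.2 (Submodule.add_mem _ hv1 hwv)) h)
    have h2 : w + (v + s) ∉ Submodule.span ℚ {s} := by
      rw [show w + (v + s) = (v + w) + s by abel]
      intro h
      exact (notMem_symm _ _ hvw hsvw).2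
        ((Submodule.add_mem_iff_left _ (Submodule.mem_span_singleton_self _)).1 h)
    obtain ⟨h3, h4⟩ := notMem_symm _ _ (notMem_symm _ _ hvw hsvw).1 h2
    have := hsub' _ (W.add_mem hw (W.add_mem hv hsW)) s hsW h3 h4 h1 (hfeS s hs)
    rwa [show w + (v + s) - s = v + w by abel] at this
  have hneg : ∀ v ∈ W, FixesLine φ (e + v) → FixesLine φ (e + -v) := by
    intro v hv hfv
    by_cases hv0 : v = 0
    · simpa [hv0] using hfe
    obtain ⟨s, hs, hsv⟩ := hS v
    have hsW : s ∈ W := Submodule.subset_span hs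
    obtain ⟨hs0, hvs⟩ := notMem_symm _ _ hv0 hsv
    have h1 := hsub' s hsW v hv hs0 hvs (hfeS s hs) hfv
    have h2 : s - v ∉ Submodule.span ℚ {s} := fun h =>
      hvs ((Submodule.sub_mem_iff_right _ (Submodule.mem_span_singleton_self _)).1 h)
    obtain ⟨h3, h4⟩ := notMem_symm _ _ hs0 h2
    have := hsub' _ (W.sub_mem hsW hv) s hsW h3 h4 h1 (hfeS s hs)
    rwa [show s - v - s = -v by abel] at this
  have hzsmul : ∀ v ∈ W, FixesLine φ (e + v) → ∀ m : ℤ, FixesLine φ (e + m • v) := by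
    intro v hv hfv m
    let A : AddSubgroup V :=
      { carrier := {v | v ∈ W ∧ FixesLine φ (e + v)}
        zero_mem' := ⟨W.zero_mem, by simpa using hfe⟩
        add_mem' := fun {x y} hx hy => ⟨W.add_mem hx.1 hy.1, hadd' x hx.1 y hy.1 hx.2 hy.2⟩
        neg_mem' := fun {x} hx => ⟨W.neg_mem hx.1, hneg x hx.1 hx.2⟩ }
    exact (A.zsmul_mem (show v ∈ A from ⟨hv, hfv⟩) m).2
  have hsmul : ∀ v ∈ W, FixesLine φ (e + v) → ∀ q : ℚ, FixesLine φ (e + q • v) := by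
    intro v hv hfv q
    have h1 := hzsmul v hv hfv q.num
    rw [← Int.cast_smul_eq_zsmul ℚ] at h1
    by_cases h0 : (q.num : ℚ) • v = 0
    · have h2 : q • v = 0 := by
        rcases smul_eq_zero.1 h0 with h | h
        · have hq : q = 0 := Rat.num_eq_zero.1 (by exact_mod_cast h)
          rw [hq, zero_smul]
        · rw [h, smul_zero]
      simpa [h2] using hfe
    obtain ⟨s, hs, hsv⟩ := hS ((q.num : ℚ) • v)
    have hsW : s ∈ W := Submodule.subset_span hs
    have h2 := hzsmul s hsW (hfeS s hs) q.den
    rw [← Int.cast_smul_eq_zsmul ℚ] at h2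
    have h3 := hdiv _ (W.smul_mem _ hv) s hsW h0 hsv q.den (by simp) h1 (hfeS s hs)
      (by simpa using h2)
    have h4 : (q.den : ℚ)⁻¹ * q.num = q := by
      rw [mul_comm, ← div_eq_mul_inv, Rat.num_div_den]
    rwa [smul_smul, h4] at h3
  have hall : ∀ w ∈ W, FixesLine φ (e + w) := by
    intro w hw
    induction hw using Submodule.span_induction with
    | mem s hs => exact hfeS s hs
    | zero => simpa using hfe
    | add x y hx hy hfx hfy => exact hadd' x hx y hy hfx hfy
    | smul c x hx hfx => exact hsmul x hx hfx c
  ext p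
  induction p using Projectivization.ind with
  | h x hx0 =>
    rw [Equiv.Perm.one_apply]
    obtain ⟨c, w, hw, hx⟩ := htop x
    have hfx : FixesLine φ x := by
      by_cases hc : c = 0
      · rw [hx, hc, zero_smul, zero_add]
        exact hdir w hw (hall w hw)
      · refine (hall (c⁻¹ • w) (W.smul_mem _ hw)).of_mem_span
          (Submodule.mem_span_singleton.2 ⟨c, ?_⟩)
        rw [hx, smul_add, smul_smul, mul_inv_cancel₀ hc, one_smul]
    exact hfx hx0

/-- The fundamental theorem of projective geometry over `ℚ`, where every semilinear map is
linear. -/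
theorem Projectivization.exists_toPerm_eq {ι : Type*} [Fintype ι] (b : Module.Basis ι ℚ V)
    (hι : 3 ≤ Fintype.card ι)
    (hφ : ∀ x y z : Projectivization ℚ V, z.rep ∈ Submodule.span ℚ {x.rep, y.rep} →
      (φ z).rep ∈ Submodule.span ℚ {(φ x).rep, (φ y).rep}) :
    ∃ T : V ≃ₗ[ℚ] V, MulAction.toPerm T = φ := by
  classical
  have hcard : 2 < (Finset.univ : Finset ι).card := by rwa [Finset.card_univ]
  obtain ⟨o, i, j, -, -, -, hoi, hoj, hij⟩ := Finset.two_lt_card_iff.1 hcard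
  have hb0 : ∀ k, b k ≠ 0 := b.ne_zero
  have hnotMem : ∀ k l, k ≠ l → b k ∉ Submodule.span ℚ {b l} := fun k l hkl h => by
    have := b.linearIndependent.notMem_span_image (s := {l}) (x := k) hkl
    rw [Set.image_singleton] at this
    exact this h
  have hob0 : ∀ k, k ≠ o → b o + b k ≠ 0 := fun k hk h => hnotMem k o hk <| by
    rw [eq_neg_of_add_eq_zero_right h]
    exact Submodule.neg_mem _ (Submodule.mem_span_singleton_self _)
  set u₀ := (φ (mk ℚ (b o) (hb0 o))).rep with hu₀
  have hu₀0 : u₀ ≠ 0 := rep_nonzero _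
  have key : ∀ k, ∃ u : V, ∃ hu : u ≠ 0, φ (mk ℚ (b k) (hb0 k)) = mk ℚ u hu ∧
      (k = o → u = u₀) ∧ ∀ hk : k ≠ o, ∃ h : u₀ + u ≠ 0,
        φ (mk ℚ (b o + b k) (hob0 k hk)) = mk ℚ (u₀ + u) h := by
    intro k
    by_cases hk : k = o
    · subst hk
      exact ⟨u₀, hu₀0, (mk_rep _).symm, fun _ => rfl, fun h => (h rfl).elim⟩
    set w := (φ (mk ℚ (b k) (hb0 k))).rep with hw
    set v := (φ (mk ℚ (b o + b k) (hob0 k hk))).rep with hv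
    have hmem : v ∈ Submodule.span ℚ {u₀, w} := by
      refine hφ _ _ _ ((rep_mk_mem_iff _).2 (Submodule.add_mem _ ?_ ?_))
      · exact (rep_mk_mem_iff (hb0 o)).1 (Submodule.subset_span (by simp))
      · exact (rep_mk_mem_iff (hb0 k)).1 (Submodule.subset_span (by simp))
    obtain ⟨α, β, hαβ⟩ := Submodule.mem_span_pair.1 hmem
    have hα : α ≠ 0 := by
      rintro rfl
      rw [zero_smul, zero_add] at hαβ
      have h1 := φ.injective (eq_of_rep_mem_span (p := φ (mk ℚ (b o + b k) (hob0 k hk)))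
        (q := φ (mk ℚ (b k) (hb0 k))) (Submodule.mem_span_singleton.2 ⟨β, hαβ⟩))
      obtain ⟨c, hc⟩ := (mk_eq_mk_iff' ℚ _ _ _ _).1 h1
      refine hnotMem o k (Ne.symm hk) (Submodule.mem_span_singleton.2 ⟨c - 1, ?_⟩)
      rw [sub_smul, hc, one_smul, add_sub_cancel_right]
    have hβ : β ≠ 0 := by
      rintro rfl
      rw [zero_smul, add_zero] at hαβ
      have h1 := φ.injective (eq_of_rep_mem_span (p := φ (mk ℚ (b o + b k) (hob0 k hk)))
        (q := φ (mk ℚ (b o) (hb0 o))) (Submodule.mem_span_singleton.2 ⟨α, hαβ⟩))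
      obtain ⟨c, hc⟩ := (mk_eq_mk_iff' ℚ _ _ _ _).1 h1
      refine hnotMem k o hk (Submodule.mem_span_singleton.2 ⟨c - 1, ?_⟩)
      rw [sub_smul, hc, one_smul, add_sub_cancel_left]
    have hw0 : w ≠ 0 := rep_nonzero _
    have hsum : α • (u₀ + (α⁻¹ * β) • w) = v := by
      rw [smul_add, smul_smul, mul_inv_cancel_left₀ hα, hαβ]
    have hu : (α⁻¹ * β) • w ≠ 0 := smul_ne_zero (mul_ne_zero (inv_ne_zero hα) hβ) hw0
    have h0 : u₀ + (α⁻¹ * β) • w ≠ 0 := fun h => by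
      rw [h, smul_zero] at hsum
      exact rep_nonzero _ hsum.symm
    refine ⟨(α⁻¹ * β) • w, hu, ?_, fun h => (hk h).elim, fun _ => ⟨h0, ?_⟩⟩
    · rw [← mk_rep (φ (mk ℚ (b k) (hb0 k)))]
      exact ((mk_eq_mk_iff' ℚ _ _ hu hw0).2 ⟨α⁻¹ * β, rfl⟩).symm
    · rw [← mk_rep (φ (mk ℚ (b o + b k) (hob0 k hk)))]
      exact (mk_eq_mk_iff' ℚ _ _ _ _).2 ⟨α, hsum⟩
  choose u hu hφu huo hφou using key
  have hspan : ⊤ ≤ Submodule.span ℚ (Set.range u) := by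
    intro x _
    by_cases hx : x = 0
    · simp [hx]
    rw [← rep_mk_mem_iff hx, ← φ.apply_symm_apply (mk ℚ x hx), ← mk_rep (φ.symm _)]
    refine apply_rep_mem_span hφ (S := Set.range b) ?_ (b.mem_span _) _
    rintro _ ⟨k, rfl⟩ hk
    rw [hφu, rep_mk_mem_iff]
    exact Submodule.subset_span ⟨k, rfl⟩
  let b' := basisOfTopLeSpanOfCardEqFinrank u hspan (Module.finrank_eq_card_basis b).symm
  let T : V ≃ₗ[ℚ] V := b.equiv b' (Equiv.refl ι)
  have hT : ∀ k, T (b k) = u k := fun k => by simp [T, b']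
  have hfix : ∀ x : V, ∀ y : V, ∀ hx : x ≠ 0, ∀ hy : y ≠ 0, T x = y →
      φ (mk ℚ x hx) = mk ℚ y hy →
      ((MulAction.toPerm T : Equiv.Perm (Projectivization ℚ V))⁻¹ * φ) (mk ℚ x hx) = mk ℚ x hx := by
    rintro x _ hx hy rfl h
    rw [Equiv.Perm.mul_apply, Equiv.Perm.inv_eq_iff_eq, h]
    rfl
  have hfb : ∀ k, FixesLine ((MulAction.toPerm T)⁻¹ * φ) (b k) := fun k hk =>
    hfix _ _ hk (hu k) (hT k) (hφu k)
  refine ⟨T, (inv_mul_eq_one.1 (eq_one_of_fixesLine ?_ (S := b '' {o}ᶜ) (e := b o)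
    (b.linearIndependent.notMem_span_image (by simp)) ?_ ?_ (hfb o) ?_ ?_))⟩
  · intro x y z hz
    have h := hφ x y z hz
    have hinv : ∀ p, ((MulAction.toPerm T : Equiv.Perm (Projectivization ℚ V))⁻¹ * φ) p =
        T⁻¹ • φ p := fun p => rfl
    simp only [hinv]
    rw [rep_smul_mem_iff]
    have hle : Submodule.span ℚ {(φ x).rep, (φ y).rep} ≤ Submodule.comap
        (T⁻¹ : V ≃ₗ[ℚ] V).toLinearMap (Submodule.span ℚ {(T⁻¹ • φ x).rep, (T⁻¹ • φ y).rep}) := by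
      refine Submodule.span_le.2 (Set.pair_subset ?_ ?_)
      · exact (rep_smul_mem_iff _ _).1 (Submodule.subset_span (by simp))
      · exact (rep_smul_mem_iff _ _).1 (Submodule.subset_span (by simp))
    exact hle h
  · intro x
    refine ⟨b.repr x o, ∑ k ∈ Finset.univ.erase o, b.repr x k • b k, ?_, ?_⟩
    · refine Submodule.sum_mem _ fun k hk => Submodule.smul_mem _ _ (Submodule.subset_span ?_)
      exact Set.mem_image_of_mem _ (Finset.ne_of_mem_erase hk)
    · rw [Finset.add_sum_erase _ (fun k => b.repr x k • b k) (Finset.mem_univ o), b.sum_repr]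
  · intro v
    by_contra! h
    have h1 := h _ (Set.mem_image_of_mem b (show i ∈ ({o}ᶜ : Set ι) from hoi.symm))
    have h2 := h _ (Set.mem_image_of_mem b (show j ∈ ({o}ᶜ : Set ι) from hoj.symm))
    obtain ⟨c, hc⟩ := Submodule.mem_span_singleton.1 h1
    have hc0 : c ≠ 0 := fun h => hb0 i (by simp [← hc, h])
    refine hnotMem j i hij.symm ?_
    rwa [← hc, Submodule.span_singleton_smul_eq (IsUnit.mk0 c hc0)]
  · rintro _ ⟨k, -, rfl⟩
    exact hfb k
  · rintro _ ⟨k, hk, rfl⟩ h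
    obtain ⟨h', h''⟩ := hφou k hk
    refine hfix _ _ h h' ?_ h''
    rw [map_add, hT, hT, huo o rfl]

end Rational

/-- Any group of permutations of the projective space `P(ℚ^n)` (for `n ≥ 3`)
properly containing `PGL_n(ℚ)` is highly transitive. -/
theorem pgl_maximal_highly_transitive (n : ℕ) (hn : 3 ≤ n)
    (G : Subgroup (Equiv.Perm (Projectivization ℚ (Fin n → ℚ))))
    (hsub : ∀ σ : Equiv.Perm (Projectivization ℚ (Fin n → ℚ)), IsPGL n σ → σ ∈ G)
    (hproper : ∃ σ ∈ G, ¬ IsPGL n σ) :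
    ∀ k : ℕ, 1 ≤ k → ∀ f g : Fin k → Projectivization ℚ (Fin n → ℚ),
      Function.Injective f → Function.Injective g →
      ∃ σ ∈ G, ∀ i, σ (f i) = g i := by
  have hG : ∀ T : (Fin n → ℚ) ≃ₗ[ℚ] (Fin n → ℚ), MulAction.toPerm T ∈ G := fun T =>
    hsub _ ⟨T, fun _ _ => rfl⟩
  obtain ⟨σ, hσ, hσ'⟩ := hproper
  intro k _
  refine tupleTransitive_of_not_collinear (by simpa using hn) hG (fun hcol => hσ' ?_) k
  obtain ⟨T, rfl⟩ := exists_toPerm_eq (Pi.basisFun ℚ (Fin n)) (by simpa using hn) (hcol σ hσ)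
  exact ⟨T, fun _ _ => rfl⟩
end

section
/- Let n ≥ 2 be a natural number. If G is a subgroup of the group of all permutations of ℚ^n that properly contains AGL_n(ℚ), then G is 3-transitive: for any two triples of pairwise distinct points of ℚ^n there is an element of G mapping the first triple to the second componentwise. -/
section Collinearity

variable {V : Type*} [AddCommGroup V] [Module ℚ V]

/-- Any two linearly independent families with the same index type are related by a linear
automorphism of a finite-dimensional space. -/
theorem LinearIndependent.exists_linearEquiv_apply_eq [FiniteDimensional ℚ V] {ι : Type*}
    {v w : ι → V} (hv : LinearIndependent ℚ v) (hw : LinearIndependent ℚ w) :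
    ∃ T : V ≃ₗ[ℚ] V, ∀ i, T (v i) = w i := by
  obtain ⟨T, hT⟩ := Submodule.exists_linearEquiv_restrict_eq
    (hv.linearCombinationEquiv.symm ≪≫ₗ hw.linearCombinationEquiv)
  refine ⟨T, fun i => ?_⟩
  have hi := hT (hv.linearCombinationEquiv (Finsupp.single i 1))
  simpa using hi.symm

/-- Every member of `G` maps the point dividing a segment in the ratio `k` to a point of the
line through the images of the endpoints. -/
def PreservesCollinearRatio (G : Subgroup (Equiv.Perm V)) (k : ℚ) : Prop :=
  ∀ g ∈ G, ∀ x y : V, ∃ t : ℚ, g (x + k • (y - x)) = g x + t • (g y - g x)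

namespace PreservesCollinearRatio

variable {G : Subgroup (Equiv.Perm V)} {a b c k : ℚ}

theorem zero : PreservesCollinearRatio G 0 := fun g _ x y => ⟨0, by simp⟩

theorem one : PreservesCollinearRatio G 1 := fun g _ x y => ⟨1, by simp⟩

theorem segment (ha : PreservesCollinearRatio G a) (hb : PreservesCollinearRatio G b)
    (hc : PreservesCollinearRatio G c) : PreservesCollinearRatio G (a + b * (c - a)) := by
  intro g hg x y
  obtain ⟨s, hs⟩ := ha g hg x y
  obtain ⟨t, ht⟩ := hc g hg x y
  obtain ⟨r, hr⟩ := hb g hg (x + a • (y - x)) (x + c • (y - x))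
  have hpt : x + (a + b * (c - a)) • (y - x)
      = x + a • (y - x) + b • (x + c • (y - x) - (x + a • (y - x))) := by module
  refine ⟨s + r * (t - s), ?_⟩
  rw [hpt, hr, hs, ht]
  module

theorem mul (ha : PreservesCollinearRatio G a) (hb : PreservesCollinearRatio G b) :
    PreservesCollinearRatio G (a * b) := by
  simpa [mul_comm] using zero.segment hb ha

theorem one_sub (ha : PreservesCollinearRatio G a) : PreservesCollinearRatio G (1 - a) := by
  simpa [sub_eq_add_neg] using one.segment ha zero

theorem inv (ha : PreservesCollinearRatio G a) : PreservesCollinearRatio G a⁻¹ := by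
  rcases eq_or_ne a 0 with rfl | h0
  · simpa using ha
  intro g hg x y
  obtain ⟨t, ht⟩ := ha g hg x (x + a⁻¹ • (y - x))
  have hpt : x + a • (x + a⁻¹ • (y - x) - x) = y := by
    rw [add_sub_cancel_left, smul_smul, mul_inv_cancel₀ h0, one_smul, add_sub_cancel]
  rw [hpt] at ht
  rcases eq_or_ne t 0 with rfl | ht0
  · have hyx : y = x := g.injective (by simpa using ht)
    exact ⟨0, by simp [hyx]⟩
  · refine ⟨t⁻¹, ?_⟩
    rw [ht, add_sub_cancel_left, smul_smul, inv_mul_cancel₀ ht0, one_smul, add_sub_cancel]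

theorem add (hk : PreservesCollinearRatio G k) (h0 : k ≠ 0) (h1 : k ≠ 1)
    (ha : PreservesCollinearRatio G a) (hb : PreservesCollinearRatio G b) :
    PreservesCollinearRatio G (a + b) := by
  have h1' : 1 - k ≠ 0 := sub_ne_zero.2 h1.symm
  convert (ha.mul hk.one_sub.inv).segment hk (hb.mul hk.inv) using 1
  field_simp
  ring

/-- A single nontrivial ratio forces all of them. -/
theorem all (hk : PreservesCollinearRatio G k) (h0 : k ≠ 0) (h1 : k ≠ 1) (q : ℚ) :
    PreservesCollinearRatio G q := by
  have hneg : PreservesCollinearRatio G (-1) := by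
    simpa using (hk.add h0 h1 one one).one_sub
  let K : Subfield ℚ :=
    { carrier := {q | PreservesCollinearRatio G q}
      mul_mem' := mul
      one_mem' := one
      add_mem' := hk.add h0 h1
      zero_mem' := zero
      neg_mem' := fun hx => by simpa using hneg.mul hx
      inv_mem' := fun _ hx => hx.inv }
  have hq : q ∈ K := Subsingleton.elim ⊤ K ▸ Subfield.mem_top q
  exact hq

end PreservesCollinearRatio

/-- A permutation fixing the origin that, along with its inverse, maps lines into lines
is additive on linearly independent pairs. -/
theorem Equiv.Perm.map_add_of_linearIndependent (f : Equiv.Perm V) (h0 : f 0 = 0)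
    (hf : ∀ (k : ℚ) (x y : V), ∃ t : ℚ, f (x + k • (y - x)) = f x + t • (f y - f x))
    (hf' : ∀ (k : ℚ) (x y : V),
      ∃ t : ℚ, f.symm (x + k • (y - x)) = f.symm x + t • (f.symm y - f.symm x))
    {u v : V} (huv : LinearIndependent ℚ ![u, v]) : f (u + v) = f u + f v := by
  -- If `b ≠ 1` then the images of the parallel lines `ℚ u` and `v + ℚ u` would meet.
  have key : ∀ {u v : V}, LinearIndependent ℚ ![u, v] → ∀ a b : ℚ,
      f (u + v) = a • f u + b • f v → b = 1 := by
    intro u v huv a b hab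
    by_contra hb
    have hb' : 1 - b ≠ 0 := sub_ne_zero.2 (Ne.symm hb)
    obtain ⟨s, hs⟩ := hf' ((1 - b)⁻¹ * a) 0 (f u)
    obtain ⟨t, ht⟩ := hf' (1 - b)⁻¹ (f v) (f (u + v))
    have hsymm : f.symm 0 = 0 := by rw [Equiv.symm_apply_eq, h0]
    have hpt : f v + (1 - b)⁻¹ • (f (u + v) - f v)
        = 0 + ((1 - b)⁻¹ * a) • (f u - 0) := by
      rw [hab]
      match_scalars
      · field_simp
        ring
      · field_simp
    rw [hpt, hs] at ht
    simp only [hsymm, Equiv.symm_apply_apply] at ht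
    have := LinearIndependent.pair_iff.1 huv (s - t) (-1) (by
      rw [← sub_eq_zero] at ht
      rw [← ht]
      module)
    norm_num at this
  obtain ⟨s, hs⟩ := hf (1 / 2) u v
  obtain ⟨t, ht⟩ := hf 2 0 (u + (1 / 2 : ℚ) • (v - u))
  have hpt : (0 : V) + (2 : ℚ) • (u + (1 / 2 : ℚ) • (v - u) - 0) = u + v := by module
  rw [hpt, hs, h0] at ht
  have hb := key huv (t * (1 - s)) (t * s) (by rw [ht]; module)
  have ha := key (LinearIndependent.pair_symm_iff.1 huv) (t * s) (t * (1 - s))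
    (by rw [add_comm v u, ht]; module)
  have hab : f (u + v) = (t * (1 - s)) • f u + (t * s) • f v := by rw [ht]; module
  rw [hab, ha, hb, one_smul, one_smul]

/-- Fundamental theorem of affine geometry over `ℚ`, for maps fixing the origin. -/
theorem Equiv.Perm.map_add_of_map_lines (hV : 1 < Module.finrank ℚ V) (f : Equiv.Perm V)
    (h0 : f 0 = 0)
    (hf : ∀ (k : ℚ) (x y : V), ∃ t : ℚ, f (x + k • (y - x)) = f x + t • (f y - f x))
    (hf' : ∀ (k : ℚ) (x y : V),
      ∃ t : ℚ, f.symm (x + k • (y - x)) = f.symm x + t • (f.symm y - f.symm x))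
    (u v : V) : f (u + v) = f u + f v := by
  have hadd {u v : V} (h : LinearIndependent ℚ ![u, v]) : f (u + v) = f u + f v :=
    f.map_add_of_linearIndependent h0 hf hf' h
  rcases eq_or_ne u 0 with rfl | hu
  · simp [h0]
  by_cases huv : LinearIndependent ℚ ![u, v]
  · exact hadd huv
  rw [LinearIndependent.pair_iff' hu] at huv
  push Not at huv
  obtain ⟨c, rfl⟩ := huv
  obtain ⟨w, hw⟩ := exists_linearIndependent_pair_of_one_lt_finrank hV hu
  have hw' := LinearIndependent.pair_iff.1 hw
  have hmul (d : ℚ) : f (d • u + w) = f (d • u) + f w := by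
    rcases eq_or_ne d 0 with rfl | hd
    · simp [h0]
    refine hadd (LinearIndependent.pair_iff.2 fun s t hst => ?_)
    have := hw' (s * d) t (by rw [mul_smul, hst])
    simpa [hd] using this
  have h1 : f (u + (c • u + w)) = f u + f (c • u + w) := by
    refine hadd (LinearIndependent.pair_iff.2 fun s t hst => ?_)
    obtain ⟨h1, h2⟩ := hw' (s + t * c) t (by rw [← hst]; module)
    subst h2
    simpa using h1
  have h2 := hmul (1 + c)
  rw [show (1 + c) • u = u + c • u by module] at h2
  rw [← add_assoc, h2, hmul c, ← add_assoc] at h1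
  exact add_right_cancel h1

end Collinearity

/-- A group containing `AGL_n(ℚ)` all of whose members map lines into lines is `AGL_n(ℚ)`. -/
theorem isAGL_of_preservesCollinearRatio {n : ℕ} (hn : 2 ≤ n)
    {G : Subgroup (Equiv.Perm (Fin n → ℚ))} (hG : ∀ k, PreservesCollinearRatio G k)
    (hsub : ∀ σ : Equiv.Perm (Fin n → ℚ), IsAGL n σ → σ ∈ G)
    {σ : Equiv.Perm (Fin n → ℚ)} (hσ : σ ∈ G) : IsAGL n σ := by
  have htrans : Equiv.addRight (-σ 0) ∈ G :=
    hsub _ ⟨LinearEquiv.refl ℚ _, -σ 0, fun x => by simp⟩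
  set f : Equiv.Perm (Fin n → ℚ) := Equiv.addRight (-σ 0) * σ
  have hf : f ∈ G := G.mul_mem htrans hσ
  have hfx (x) : f x = σ x + -σ 0 := rfl
  have hadd := f.map_add_of_map_lines (by simpa using Nat.lt_of_succ_le hn) (by simp [hfx])
    (fun k => hG k f hf) (fun k => hG k f⁻¹ (G.inv_mem hf))
  let F : (Fin n → ℚ) →+ (Fin n → ℚ) := AddMonoidHom.mk' f hadd
  refine ⟨LinearEquiv.ofBijective F.toRatLinearMap f.bijective, σ 0, fun x => ?_⟩
  change σ x = f x + σ 0
  rw [hfx, neg_add_cancel_right]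

/-- For a fixed index type, `AGL_n(ℚ)` is transitive on affinely independent families with a
distinguished base point. -/
theorem exists_isAGL_apply_eq {n : ℕ} {ι : Type*} {v w : ι → Fin n → ℚ} {a b : Fin n → ℚ}
    (hv : LinearIndependent ℚ fun i => v i - a) (hw : LinearIndependent ℚ fun i => w i - b) :
    ∃ σ : Equiv.Perm (Fin n → ℚ), IsAGL n σ ∧ σ a = b ∧ ∀ i, σ (v i) = w i := by
  obtain ⟨T, hT⟩ := hv.exists_linearEquiv_apply_eq hw
  refine ⟨T.toEquiv.trans (Equiv.addRight (b - T a)), ⟨T, b - T a, fun x => rfl⟩, ?_, fun i => ?_⟩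
  · change T a + (b - T a) = b
    abel
  · change T (v i) + (b - T a) = w i
    have := hT i
    rw [map_sub, sub_eq_sub_iff_add_eq_add] at this
    rw [← add_sub_assoc, this, add_sub_cancel_right]

/-- Any group of permutations of `ℚ^n` (for `n ≥ 2`) properly containing `AGL_n(ℚ)`
is 3-transitive. -/
theorem agl_proper_supergroup_three_transitive (n : ℕ) (hn : 2 ≤ n)
    (G : Subgroup (Equiv.Perm (Fin n → ℚ)))
    (hsub : ∀ σ : Equiv.Perm (Fin n → ℚ), IsAGL n σ → σ ∈ G)
    (hproper : ∃ σ ∈ G, ¬ IsAGL n σ) :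
    ∀ a b c a' b' c' : Fin n → ℚ,
      a ≠ b → a ≠ c → b ≠ c → a' ≠ b' → a' ≠ c' → b' ≠ c' →
      ∃ σ ∈ G, σ a = a' ∧ σ b = b' ∧ σ c = c' := by
  have hratio (k : ℚ) (h0 : k ≠ 0) (h1 : k ≠ 1) : ¬ PreservesCollinearRatio G k := by
    intro hk
    obtain ⟨σ, hσ, hnot⟩ := hproper
    exact hnot (isAGL_of_preservesCollinearRatio hn (hk.all h0 h1) hsub hσ)
  have hgeneric (a b c : Fin n → ℚ) (hab : a ≠ b) (hac : a ≠ c) (hbc : b ≠ c) :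
      ∃ g ∈ G, LinearIndependent ℚ ![g b - g a, g c - g a] := by
    by_cases hli : LinearIndependent ℚ ![b - a, c - a]
    · exact ⟨1, G.one_mem, hli⟩
    rw [LinearIndependent.pair_iff' (sub_ne_zero.2 hab.symm)] at hli
    push Not at hli
    obtain ⟨k, hk⟩ := hli
    obtain rfl : c = a + k • (b - a) := by rw [hk, add_sub_cancel]
    have hk0 : k ≠ 0 := by rintro rfl; simp at hac
    have hk1 : k ≠ 1 := by rintro rfl; simp at hbc
    have hnot := hratio k hk0 hk1
    unfold PreservesCollinearRatio at hnot
    push Not at hnot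
    obtain ⟨g, hg, x, y, hxy⟩ := hnot
    have hne : y ≠ x := by
      rintro rfl
      exact hxy 0 (by simp)
    obtain ⟨σ, ⟨T, d, hT⟩, hσa, hσb⟩ := exists_isAGL_apply_eq
      (v := fun _ : Unit => b) (w := fun _ => y) (a := a) (b := x)
      (LinearIndependent.of_subsingleton () (sub_ne_zero.2 hab.symm))
      (LinearIndependent.of_subsingleton () (sub_ne_zero.2 hne))
    have hσb := hσb ()
    have hσc : σ (a + k • (b - a)) = x + k • (y - x) := by
      rw [← hσa, ← hσb]
      simp only [hT, map_add, map_smul, map_sub]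
      module
    refine ⟨g * σ, G.mul_mem hg (hsub σ ⟨T, d, hT⟩), ?_⟩
    simp only [Equiv.Perm.mul_apply, hσa, hσb, hσc]
    rw [LinearIndependent.pair_iff' (sub_ne_zero.2 (g.injective.ne hne))]
    intro t ht
    exact hxy t (by rw [ht, add_sub_cancel])
  intro a b c a' b' c' hab hac hbc hab' hac' hbc'
  obtain ⟨g, hg, hli⟩ := hgeneric a b c hab hac hbc
  obtain ⟨g', hg', hli'⟩ := hgeneric a' b' c' hab' hac' hbc'
  obtain ⟨σ, hσ, hσa, hσbc⟩ := exists_isAGL_apply_eq (v := ![g b, g c]) (w := ![g' b', g' c'])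
    (a := g a) (b := g' a')
    (by convert hli using 1; ext i; fin_cases i <;> rfl)
    (by convert hli' using 1; ext i; fin_cases i <;> rfl)
  refine ⟨g'⁻¹ * (σ * g), G.mul_mem (G.inv_mem hg') (G.mul_mem (hsub σ hσ) hg), ?_, ?_, ?_⟩
  · simp [hσa]
  · simpa using congrArg g'.symm (hσbc 0)
  · simpa using congrArg g'.symm (hσbc 1)
end

section
/- Let n ≥ 2, let σ be a permutation of ℚ^n, and let L = ℚ·v for some v ≠ 0 be a line through 0 such that the image σ(L) is not contained in any affine line of ℚ^n. Then for every r ∈ ℚ with r ≠ 0 and r ≠ 1, there exist points a ≠ b on L such that the images σ(a), σ(b), σ(r·a + (1−r)·b) are not collinear. -/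
/-- A set containing `0` and `d` and closed under `(x, y) ↦ r * x + (1 - r) * y`
and under both divisions of this operation contains every integer multiple of `d`. -/
theorem int_mul_mem_of_ratio_closed {K : Type*} [Field K] {r : K} (hr₀ : r ≠ 0) (hr₁ : r ≠ 1)
    {S : Set K} (hmul : ∀ x ∈ S, ∀ y ∈ S, r * x + (1 - r) * y ∈ S)
    (hleft : ∀ x, ∀ y ∈ S, r * x + (1 - r) * y ∈ S → x ∈ S)
    (hright : ∀ x ∈ S, ∀ y, r * x + (1 - r) * y ∈ S → y ∈ S)
    {d : K} (h₀ : 0 ∈ S) (hd : d ∈ S) (m : ℤ) : (m : K) * d ∈ S := by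
  have hr₁' : 1 - r ≠ 0 := sub_ne_zero.2 hr₁.symm
  have shift_left : ∀ x ∈ S, ∀ s ∈ S, ∀ t ∈ S, x + (1 - r) / r * (s - t) ∈ S := by
    intro x hx s hs t ht
    refine hleft _ t ht ?_
    convert hmul x hx s hs using 1
    field_simp
    ring
  have shift_right : ∀ x ∈ S, ∀ s ∈ S, ∀ t ∈ S, x + r / (1 - r) * (s - t) ∈ S := by
    intro x hx s hs t ht
    refine hright t ht _ ?_
    convert hmul s hs x hx using 1
    field_simp
    ring
  have hw : r / (1 - r) * d ∈ S := by simpa using shift_right 0 h₀ d hd 0 h₀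
  have hadd : ∀ x ∈ S, x + d ∈ S := by
    intro x hx
    convert shift_left x hx _ hw 0 h₀ using 1
    field_simp
    ring
  have hsub : ∀ x ∈ S, x - d ∈ S := by
    intro x hx
    convert shift_left x hx 0 h₀ _ hw using 1
    field_simp
    ring
  induction m using Int.induction_on with
  | zero => simpa using h₀
  | succ i ih =>
    convert hadd _ ih using 1
    push_cast
    ring
  | pred i ih =>
    convert hsub _ ih using 1
    push_cast
    ring

/-- If a collinear triple has two distinct points in an affine subspace, the third one
lies in it as well. -/
theorem Collinear.mem_affineSubspace_of_mem {k V P : Type*} [DivisionRing k] [AddCommGroup V]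
    [Module k V] [AddTorsor V P] {s : Set P} (h : Collinear k s) {p₁ p₂ p₃ : P}
    (h₁ : p₁ ∈ s) (h₂ : p₂ ∈ s) (h₃ : p₃ ∈ s) (hne : p₁ ≠ p₂) {l : AffineSubspace k P}
    (hl₁ : p₁ ∈ l) (hl₂ : p₂ ∈ l) : p₃ ∈ l :=
  affineSpan_pair_le_of_mem_of_mem hl₁ hl₂ (h.mem_affineSpan_of_mem_of_ne h₁ h₂ h₃ hne)

/-- An injective map on `ℚ` sending every triple of ratio `r` to a collinear triple has
collinear range. -/
theorem collinear_range_of_ratio {V P : Type*} [AddCommGroup V] [Module ℚ V] [AddTorsor V P]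
    {f : ℚ → P} (hf : Function.Injective f) {r : ℚ} (hr₀ : r ≠ 0) (hr₁ : r ≠ 1)
    (h : ∀ a b, a ≠ b → Collinear ℚ {f a, f b, f (r * a + (1 - r) * b)}) :
    Collinear ℚ (Set.range f) := by
  have hr₁' : 1 - r ≠ 0 := sub_ne_zero.2 hr₁.symm
  have key : ∀ (l : AffineSubspace ℚ P) (d : ℚ), f 0 ∈ l → f d ∈ l →
      ∀ m : ℤ, f (m * d) ∈ l := by
    intro l d h₀ hd m
    refine int_mul_mem_of_ratio_closed (S := f ⁻¹' l) hr₀ hr₁ ?_ ?_ ?_ h₀ hd m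
    · intro x hx y hy
      rcases eq_or_ne x y with rfl | hxy
      · rwa [← add_mul, add_sub_cancel, one_mul]
      · exact (h x y hxy).mem_affineSubspace_of_mem (by simp) (by simp) (by simp)
          (hf.ne hxy) hx hy
    · intro x y hy hz
      rcases eq_or_ne x y with rfl | hxy
      · exact hy
      · refine (h x y hxy).mem_affineSubspace_of_mem (by simp) (by simp) (by simp)
          (hf.ne fun e => hxy ?_) hy hz
        exact mul_left_cancel₀ hr₀ (by linear_combination -e)
    · intro x hx y hz
      rcases eq_or_ne x y with rfl | hxy
      · exact hx
      · refine (h x y hxy).mem_affineSubspace_of_mem (by simp) (by simp) (by simp)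
          (hf.ne fun e => hxy ?_) hx hz
        exact mul_left_cancel₀ hr₁' (by linear_combination e)
  have hspan : Set.range f ⊆ line[ℚ, f 0, f 1] := by
    rintro _ ⟨q, rfl⟩
    have hden : (q.den : ℚ) ≠ 0 := by exact_mod_cast q.den_nz
    have hmem := key line[ℚ, f 0, f (q.den : ℚ)⁻¹] (q.den : ℚ)⁻¹
      (left_mem_affineSpan_pair ..) (right_mem_affineSpan_pair ..)
    have hone : f 1 ∈ line[ℚ, f 0, f (q.den : ℚ)⁻¹] := by
      simpa [hden] using hmem q.den
    have hq : f q ∈ line[ℚ, f 0, f (q.den : ℚ)⁻¹] := by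
      simpa [← div_eq_mul_inv, Rat.num_div_den] using hmem q.num
    have hcol : Collinear ℚ {f 0, f 1, f q} :=
      collinear_triple_of_mem_affineSpan_pair (left_mem_affineSpan_pair ..) hone hq
    exact hcol.mem_affineSpan_of_mem_of_ne (by simp) (by simp) (by simp) (hf.ne zero_ne_one)
  have hline : Collinear ℚ (line[ℚ, f 0, f 1] : Set P) := by
    rw [Collinear, ← AffineSubspace.direction_eq_vectorSpan, direction_affineSpan]
    exact collinear_pair ℚ (f 0) (f 1)
  exact hline.subset hspan


/-- If `σ` is a permutation of `ℚ^n` (`n ≥ 2`) and `L = ℚ·v` is a line through `0`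
whose image under `σ` is not contained in any affine line, then for every ratio
`r ∉ {0,1}` there are points `a ≠ b` on `L` whose images, together with the image
of `r•a + (1-r)•b`, are not collinear. -/
theorem exists_ratio_triple_not_collinear (n : ℕ) (hn : 2 ≤ n)
    (σ : Equiv.Perm (Fin n → ℚ)) (v : Fin n → ℚ) (hv : v ≠ 0)
    (L : Set (Fin n → ℚ)) (hL : L = Set.range fun t : ℚ => t • v)
    (himg : ¬ Collinear ℚ (σ '' L)) :
    ∀ r : ℚ, r ≠ 0 → r ≠ 1 →
      ∃ a ∈ L, ∃ b ∈ L, a ≠ b ∧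
        ¬ Collinear ℚ ({σ a, σ b, σ (r • a + (1 - r) • b)} : Set (Fin n → ℚ)) := by
  intro r hr₀ hr₁
  subst hL
  by_contra! hcon
  apply himg
  rw [← Set.range_comp]
  have hinj : Function.Injective fun t : ℚ => t • v := smul_left_injective ℚ hv
  refine collinear_range_of_ratio (σ.injective.comp hinj) hr₀ hr₁ fun a b hab => ?_
  simpa [add_smul, mul_smul] using hcon _ ⟨a, rfl⟩ _ ⟨b, rfl⟩ (hinj.ne hab)
end
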